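/- For each n ∈ ℕ and every countable model M of IΣ_{n+2}, there is a proper Σ_{n+2}-elementary end extension M ≼_{e,Σ_{n+2}} K such that K ⊨ M-IΣ_{n+1}. -/

import Mathlib

namespace PaperArith

/-! ## Syntax of (two-sorted) first-order arithmetic

Terms and formulas of arithmetic in the language `{0, 1, +, ·, <}`,
with number variables and (monadic second-order) set variables both indexed
by natural numbers.  Bounded quantifiers are taken as primitives, so that the
class `Δ₀` of bounded formulas is a purely syntactic class. -/

/-- Terms of first-order arithmetic in the language `{0, 1, +, ·, <}`. -/
inductive Term : Type
  | var : ℕ → Term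
  | zero : Term
  | one : Term
  | add : Term → Term → Term
  | mul : Term → Term → Term

/-- Formulas of (two-sorted) arithmetic.  `mem t i` is the atomic formula
`t ∈ Xᵢ`; `ball x t φ` is `∀ x < t, φ` and `bex x t φ` is `∃ x < t, φ`;
`sall i φ` and `sex i φ` quantify over the set variable `Xᵢ`.
Purely first-order formulas are those avoiding `mem`, `sall`, `sex`. -/
inductive Fml : Type
  | eq : Term → Term → Fml
  | lt : Term → Term → Fml
  | mem : Term → ℕ → Fml
  | not : Fml → Fml
  | and : Fml → Fml → Fml
  | or : Fml → Fml → Fml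
  | imp : Fml → Fml → Fml
  | all : ℕ → Fml → Fml
  | ex : ℕ → Fml → Fml
  | ball : ℕ → Term → Fml → Fml
  | bex : ℕ → Term → Fml → Fml
  | sall : ℕ → Fml → Fml
  | sex : ℕ → Fml → Fml

/-- A structure for the first-order language of arithmetic. -/
structure Str : Type 1 where
  M : Type
  zero : M
  one : M
  add : M → M → M
  mul : M → M → M
  lt : M → M → Prop

/-- Value of a term under a valuation of the number variables. -/
def tval (S : Str) (v : ℕ → S.M) : Term → S.M
  | .var i => v i
  | .zero => S.zero
  | .one => S.one
  | .add t u => S.add (tval S v t) (tval S v u)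
  | .mul t u => S.mul (tval S v t) (tval S v u)

/-- Update a valuation at one variable. -/
def upd {α : Type} (v : ℕ → α) (x : ℕ) (a : α) : ℕ → α :=
  fun i => if i = x then a else v i

/-- Tarskian satisfaction over the structure `S`, with second-order universe
`X` (set quantifiers range over `X`); `v` is the valuation of number
variables, `w` the valuation of set variables. -/
def Sat (S : Str) (X : Set (Set S.M)) : (ℕ → S.M) → (ℕ → Set S.M) → Fml → Prop
  | v, _, .eq t u => tval S v t = tval S v u
  | v, _, .lt t u => S.lt (tval S v t) (tval S v u)
  | v, w, .mem t i => tval S v t ∈ w i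
  | v, w, .not φ => ¬ Sat S X v w φ
  | v, w, .and φ ψ => Sat S X v w φ ∧ Sat S X v w ψ
  | v, w, .or φ ψ => Sat S X v w φ ∨ Sat S X v w ψ
  | v, w, .imp φ ψ => Sat S X v w φ → Sat S X v w ψ
  | v, w, .all x φ => ∀ m : S.M, Sat S X (upd v x m) w φ
  | v, w, .ex x φ => ∃ m : S.M, Sat S X (upd v x m) w φ
  | v, w, .ball x t φ => ∀ m : S.M, S.lt m (tval S v t) → Sat S X (upd v x m) w φ
  | v, w, .bex x t φ => ∃ m : S.M, S.lt m (tval S v t) ∧ Sat S X (upd v x m) w φ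
  | v, w, .sall i φ => ∀ A : Set S.M, A ∈ X → Sat S X v (upd w i A) φ
  | v, w, .sex i φ => ∃ A : Set S.M, A ∈ X ∧ Sat S X v (upd w i A) φ

/-- First-order satisfaction (for purely first-order formulas the second-order
data is irrelevant). -/
def Sat0 (S : Str) (v : ℕ → S.M) (φ : Fml) : Prop :=
  Sat S ∅ v (fun _ => ∅) φ

/-! ## The arithmetic hierarchy -/

/-- `Δ₀` formulas: purely first-order, only bounded quantifiers. -/
inductive Delta0 : Fml → Prop
  | eq (t u : Term) : Delta0 (.eq t u)
  | lt (t u : Term) : Delta0 (.lt t u)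
  | not {φ : Fml} : Delta0 φ → Delta0 (.not φ)
  | and {φ ψ : Fml} : Delta0 φ → Delta0 ψ → Delta0 (.and φ ψ)
  | or {φ ψ : Fml} : Delta0 φ → Delta0 ψ → Delta0 (.or φ ψ)
  | imp {φ ψ : Fml} : Delta0 φ → Delta0 ψ → Delta0 (.imp φ ψ)
  | ball (x : ℕ) (t : Term) {φ : Fml} : Delta0 φ → Delta0 (.ball x t φ)
  | bex (x : ℕ) (t : Term) {φ : Fml} : Delta0 φ → Delta0 (.bex x t φ)

mutual
  /-- `Σₙ` formulas of the first-order arithmetic hierarchy. -/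
  inductive IsSigma : ℕ → Fml → Prop
    | delta0 {n : ℕ} {φ : Fml} : Delta0 φ → IsSigma n φ
    | ofPi {n : ℕ} {φ : Fml} : IsPi n φ → IsSigma (n + 1) φ
    | ex (x : ℕ) {n : ℕ} {φ : Fml} : IsSigma (n + 1) φ → IsSigma (n + 1) (.ex x φ)
  /-- `Πₙ` formulas of the first-order arithmetic hierarchy. -/
  inductive IsPi : ℕ → Fml → Prop
    | delta0 {n : ℕ} {φ : Fml} : Delta0 φ → IsPi n φ
    | ofSigma {n : ℕ} {φ : Fml} : IsSigma n φ → IsPi (n + 1) φ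
    | all (x : ℕ) {n : ℕ} {φ : Fml} : IsPi (n + 1) φ → IsPi (n + 1) (.all x φ)
end

/-- `Σ₀(Σₙ)`: the closure of `Σₙ` under Boolean operations and bounded
quantification. -/
inductive Sigma0Sigma (n : ℕ) : Fml → Prop
  | ofSigma {φ : Fml} : IsSigma n φ → Sigma0Sigma n φ
  | not {φ : Fml} : Sigma0Sigma n φ → Sigma0Sigma n (.not φ)
  | and {φ ψ : Fml} : Sigma0Sigma n φ → Sigma0Sigma n ψ → Sigma0Sigma n (.and φ ψ)
  | or {φ ψ : Fml} : Sigma0Sigma n φ → Sigma0Sigma n ψ → Sigma0Sigma n (.or φ ψ)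
  | imp {φ ψ : Fml} : Sigma0Sigma n φ → Sigma0Sigma n ψ → Sigma0Sigma n (.imp φ ψ)
  | ball (x : ℕ) (t : Term) {φ : Fml} : Sigma0Sigma n φ → Sigma0Sigma n (.ball x t φ)
  | bex (x : ℕ) (t : Term) {φ : Fml} : Sigma0Sigma n φ → Sigma0Sigma n (.bex x t φ)

/-- The class `Σₙ ∧ Πₙ` of conjunctions of a `Σₙ` and a `Πₙ` formula. -/
def SigmaAndPi (n : ℕ) (φ : Fml) : Prop :=
  ∃ ψ χ : Fml, IsSigma n ψ ∧ IsPi n χ ∧ φ = Fml.and ψ χ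

/-- The class `Σₙ ∨ Πₙ` of disjunctions of a `Σₙ` and a `Πₙ` formula. -/
def SigmaOrPi (n : ℕ) (φ : Fml) : Prop :=
  ∃ ψ χ : Fml, IsSigma n ψ ∧ IsPi n χ ∧ φ = Fml.or ψ χ

/-- `Δ₀⁰` formulas of second-order arithmetic: only bounded first-order
quantifiers; free set variables (set parameters) are allowed. -/
inductive Delta0SO : Fml → Prop
  | eq (t u : Term) : Delta0SO (.eq t u)
  | lt (t u : Term) : Delta0SO (.lt t u)
  | mem (t : Term) (i : ℕ) : Delta0SO (.mem t i)
  | not {φ : Fml} : Delta0SO φ → Delta0SO (.not φ)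
  | and {φ ψ : Fml} : Delta0SO φ → Delta0SO ψ → Delta0SO (.and φ ψ)
  | or {φ ψ : Fml} : Delta0SO φ → Delta0SO ψ → Delta0SO (.or φ ψ)
  | imp {φ ψ : Fml} : Delta0SO φ → Delta0SO ψ → Delta0SO (.imp φ ψ)
  | ball (x : ℕ) (t : Term) {φ : Fml} : Delta0SO φ → Delta0SO (.ball x t φ)
  | bex (x : ℕ) (t : Term) {φ : Fml} : Delta0SO φ → Delta0SO (.bex x t φ)

mutual
  /-- `Σₙ⁰` formulas of the second-order arithmetic hierarchy
  (set parameters allowed, no set quantifiers). -/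
  inductive SigmaSO : ℕ → Fml → Prop
    | delta0 {n : ℕ} {φ : Fml} : Delta0SO φ → SigmaSO n φ
    | ofPi {n : ℕ} {φ : Fml} : PiSO n φ → SigmaSO (n + 1) φ
    | ex (x : ℕ) {n : ℕ} {φ : Fml} : SigmaSO (n + 1) φ → SigmaSO (n + 1) (.ex x φ)
  /-- `Πₙ⁰` formulas of the second-order arithmetic hierarchy. -/
  inductive PiSO : ℕ → Fml → Prop
    | delta0 {n : ℕ} {φ : Fml} : Delta0SO φ → PiSO n φ
    | ofSigma {n : ℕ} {φ : Fml} : SigmaSO n φ → PiSO (n + 1) φ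
    | all (x : ℕ) {n : ℕ} {φ : Fml} : PiSO (n + 1) φ → PiSO (n + 1) (.all x φ)
end

/-! ## First-order theories -/

/-- `PA⁻`: the theory of non-negative parts of discretely ordered rings. -/
structure PAminus (S : Str) : Prop where
  add_assoc : ∀ a b c, S.add (S.add a b) c = S.add a (S.add b c)
  add_comm : ∀ a b, S.add a b = S.add b a
  mul_assoc : ∀ a b c, S.mul (S.mul a b) c = S.mul a (S.mul b c)
  mul_comm : ∀ a b, S.mul a b = S.mul b a
  distrib : ∀ a b c, S.mul a (S.add b c) = S.add (S.mul a b) (S.mul a c)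
  add_zero : ∀ a, S.add a S.zero = a
  mul_zero : ∀ a, S.mul a S.zero = S.zero
  mul_one : ∀ a, S.mul a S.one = a
  lt_irrefl : ∀ a, ¬ S.lt a a
  lt_trans : ∀ a b c, S.lt a b → S.lt b c → S.lt a c
  lt_total : ∀ a b, S.lt a b ∨ a = b ∨ S.lt b a
  add_lt_add : ∀ a b c, S.lt a b → S.lt (S.add a c) (S.add b c)
  mul_lt_mul : ∀ a b c, S.lt a b → S.lt S.zero c → S.lt (S.mul a c) (S.mul b c)
  zero_lt_one : S.lt S.zero S.one
  zero_le : ∀ a, a = S.zero ∨ S.lt S.zero a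
  discrete : ∀ a b, S.lt a b → S.add a S.one = b ∨ S.lt (S.add a S.one) b
  pred : ∀ a, S.lt S.zero a → ∃ b, S.add b S.one = a
  sub : ∀ a b, S.lt a b → ∃ c, S.add a c = b

/-- The induction scheme for the class `Γ` of formulas
(parameters are allowed via the ambient valuation `v`). -/
def IndFor (S : Str) (Γ : Fml → Prop) : Prop :=
  ∀ φ : Fml, Γ φ → ∀ (v : ℕ → S.M) (x : ℕ),
    Sat0 S (upd v x S.zero) φ →
    (∀ m, Sat0 S (upd v x m) φ → Sat0 S (upd v x (S.add m S.one)) φ) →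
    ∀ m, Sat0 S (upd v x m) φ

/-- The collection scheme for the class `Γ`:
`(∀ x < a ∃ y φ) → (∃ b ∀ x < a ∃ y < b φ)`. -/
def CollFor (S : Str) (Γ : Fml → Prop) : Prop :=
  ∀ φ : Fml, Γ φ → ∀ (v : ℕ → S.M) (x y : ℕ), x ≠ y → ∀ a : S.M,
    (∀ m, S.lt m a → ∃ k, Sat0 S (upd (upd v x m) y k) φ) →
    ∃ b, ∀ m, S.lt m a → ∃ k, S.lt k b ∧ Sat0 S (upd (upd v x m) y k) φ

/-- `IΔ₀` (over `PA⁻`). -/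
def IDelta0 (S : Str) : Prop := PAminus S ∧ IndFor S Delta0

/-- `IΣₙ` (over `PA⁻`; note `Δ₀ ⊆ Σₙ`, so this includes `IΔ₀`). -/
def ISigma (S : Str) (n : ℕ) : Prop := PAminus S ∧ IndFor S (IsSigma n)

/-- `BΣₙ`: the `Σₙ`-collection scheme, including `IΔ₀` (over `PA⁻`). -/
def BSigma (S : Str) (n : ℕ) : Prop := IDelta0 S ∧ CollFor S (IsSigma n)

/-- The weak regularity principle `WRφ` for all `φ` in the class `Γ`:
the universal closure of `(∀ x ∃ y < a φ(x,y)) → (∃ y < a ∀ b ∃ x > b φ(x,y))`.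
Here `x, y` are the two displayed variables and all other free variables of
`φ` are parameters, interpreted by the ambient valuation `v`. -/
def WRFor (S : Str) (Γ : Fml → Prop) : Prop :=
  ∀ φ : Fml, Γ φ → ∀ (v : ℕ → S.M) (x y : ℕ), x ≠ y → ∀ a : S.M,
    (∀ m, ∃ k, S.lt k a ∧ Sat0 S (upd (upd v x m) y k) φ) →
    ∃ k, S.lt k a ∧ ∀ b, ∃ m, S.lt b m ∧ Sat0 S (upd (upd v x m) y k) φ

/-! ## Second-order theories -/

/-- Second-order induction scheme for the class `Γ`, with set parameters
from the second-order universe `X`. -/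
def IndForSO (S : Str) (X : Set (Set S.M)) (Γ : Fml → Prop) : Prop :=
  ∀ φ : Fml, Γ φ → ∀ (v : ℕ → S.M) (w : ℕ → Set S.M), (∀ i, w i ∈ X) → ∀ x : ℕ,
    Sat S X (upd v x S.zero) w φ →
    (∀ m, Sat S X (upd v x m) w φ → Sat S X (upd v x (S.add m S.one)) w φ) →
    ∀ m, Sat S X (upd v x m) w φ

/-- Second-order collection scheme for the class `Γ`. -/
def CollForSO (S : Str) (X : Set (Set S.M)) (Γ : Fml → Prop) : Prop :=
  ∀ φ : Fml, Γ φ → ∀ (v : ℕ → S.M) (w : ℕ → Set S.M), (∀ i, w i ∈ X) →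
    ∀ (x y : ℕ), x ≠ y → ∀ a : S.M,
    (∀ m, S.lt m a → ∃ k, Sat S X (upd (upd v x m) y k) w φ) →
    ∃ b, ∀ m, S.lt m a → ∃ k, S.lt k b ∧ Sat S X (upd (upd v x m) y k) w φ

/-- `Δ₁⁰`-comprehension. -/
def Delta1CA (S : Str) (X : Set (Set S.M)) : Prop :=
  ∀ φ ψ : Fml, SigmaSO 1 φ → PiSO 1 ψ →
    ∀ (v : ℕ → S.M) (w : ℕ → Set S.M), (∀ i, w i ∈ X) → ∀ x : ℕ,
    (∀ m, Sat S X (upd v x m) w φ ↔ Sat S X (upd v x m) w ψ) →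
    ∃ A ∈ X, ∀ m, m ∈ A ↔ Sat S X (upd v x m) w φ

/-- `Σₙ`-comprehension for first-order formulas with parameters from `M`. -/
def SigmaCA (S : Str) (X : Set (Set S.M)) (n : ℕ) : Prop :=
  ∀ φ : Fml, IsSigma n φ → ∀ (v : ℕ → S.M) (x : ℕ),
    ∃ A ∈ X, ∀ m, m ∈ A ↔ Sat0 S (upd v x m) φ

/-- `RCA₀`. -/
def RCA0 (S : Str) (X : Set (Set S.M)) : Prop :=
  PAminus S ∧ IndForSO S X (SigmaSO 1) ∧ Delta1CA S X

/-- `Σ₁⁰`-separation; over `RCA₀` this is equivalent to weak Kőnig's lemma. -/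
def Sigma1Sep (S : Str) (X : Set (Set S.M)) : Prop :=
  ∀ φ ψ : Fml, SigmaSO 1 φ → SigmaSO 1 ψ →
    ∀ (v : ℕ → S.M) (w : ℕ → Set S.M), (∀ i, w i ∈ X) → ∀ x : ℕ,
    (∀ m, ¬ (Sat S X (upd v x m) w φ ∧ Sat S X (upd v x m) w ψ)) →
    ∃ A ∈ X, ∀ m, (Sat S X (upd v x m) w φ → m ∈ A) ∧ (m ∈ A → ¬ Sat S X (upd v x m) w ψ)

/-- `WKL₀`, rendered as `RCA₀` plus `Σ₁⁰`-separation (which is equivalent,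
over `RCA₀`, to weak Kőnig's lemma). -/
def WKL0 (S : Str) (X : Set (Set S.M)) : Prop := RCA0 S X ∧ Sigma1Sep S X

/-- `BΣₙ⁰`: the second-order `Σₙ⁰`-collection scheme (including `IΔ₀⁰`,
over `PA⁻`). -/
def BSigmaSO (S : Str) (X : Set (Set S.M)) (n : ℕ) : Prop :=
  PAminus S ∧ IndForSO S X Delta0SO ∧ CollForSO S X (SigmaSO n)

/-- `IΣₙ⁰`: the second-order `Σₙ⁰`-induction scheme, over `RCA₀`. -/
def ISigmaSO (S : Str) (X : Set (Set S.M)) (n : ℕ) : Prop :=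
  RCA0 S X ∧ IndForSO S X (SigmaSO n)

/-! ## Exponentiation and binary digits -/

/-- Satisfaction of a three-variable formula `E(x₀, x₁, x₂)` at `(a, b, c)`. -/
def ExpAt (S : Str) (E : Fml) (a b c : S.M) : Prop :=
  Sat0 S (fun i => if i = 0 then a else if i = 1 then b else c) E

/-- `E(x₀,x₁,x₂)` is a `Δ₀` definition of the (total) exponentiation function
`x₀ ^ x₁ = x₂`.  The existence of such an `E` expresses `exp`
(the totality of exponentiation). -/
structure IsExpDef (S : Str) (E : Fml) : Prop where
  delta0 : Delta0 E
  base : ∀ a, ExpAt S E a S.zero S.one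
  total : ∀ a b, ∃ c, ExpAt S E a b c
  unique : ∀ a b c c', ExpAt S E a b c → ExpAt S E a b c' → c = c'
  step : ∀ a b c, ExpAt S E a b c → ExpAt S E a (S.add b S.one) (S.mul c a)

/-- `exp`: the totality of exponentiation (via a `Δ₀` definition of its
graph). -/
def SatExp (S : Str) : Prop := ∃ E : Fml, IsExpDef S E

/-! ## Embeddings, end extensions and elementarity -/

/-- An embedding of arithmetic structures. -/
structure Emb (S K : Str) where
  j : S.M → K.M
  inj : Function.Injective j
  zero : j S.zero = K.zero
  one : j S.one = K.one
  add : ∀ a b, j (S.add a b) = K.add (j a) (j b)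
  mul : ∀ a b, j (S.mul a b) = K.mul (j a) (j b)
  lt_iff : ∀ a b, S.lt a b ↔ K.lt (j a) (j b)

/-- The extension along `e` is an end extension: every element of `K` not in
the image of `M` exceeds every element of `M`. -/
def IsEndExt {S K : Str} (e : Emb S K) : Prop :=
  ∀ b : K.M, b ∉ Set.range e.j → ∀ a : S.M, K.lt (e.j a) b

/-- The extension along `e` is proper. -/
def IsProper {S K : Str} (e : Emb S K) : Prop := ¬ Function.Surjective e.j

/-- The extension along `e` is `Σₙ`-elementary: all `Σₙ` formulas with
parameters from `M` are absolute between `M` and `K`. -/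
def SigmaElem {S K : Str} (e : Emb S K) (n : ℕ) : Prop :=
  ∀ φ : Fml, IsSigma n φ → ∀ v : ℕ → S.M,
    (Sat0 S v φ ↔ Sat0 K (fun i => e.j (v i)) φ)

/-- `K ⊨ M‑IΣₙ` (for an extension `e : M → K`): induction up to any `a ∈ M`
for `Σₙ` formulas with parameters from `K`. -/
def MISigma {S K : Str} (e : Emb S K) (n : ℕ) : Prop :=
  ∀ φ : Fml, IsSigma n φ → ∀ (v : ℕ → K.M) (x : ℕ) (a : S.M),
    Sat0 K (upd v x K.zero) φ →
    (∀ m, K.lt m (e.j a) → (Sat0 K (upd v x m) φ → Sat0 K (upd v x (K.add m K.one)) φ)) →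
    ∀ m, K.lt m (e.j a) → Sat0 K (upd v x m) φ

/-- The `x`-th binary digit of `c ∈ K` is `1`, computed via a `Δ₀` definition
`E` of exponentiation on the ground model `S` (here `x` lies under the image
of `S`): there are `x', p ∈ M` with `j x' = x`, `p = 2 ^ x'`, and `u, v ∈ K`
with `c = u·(2p) + p + v` and `v < p`. -/
def BitVia {S K : Str} (e : Emb S K) (E : Fml) (x c : K.M) : Prop :=
  ∃ x' p : S.M, e.j x' = x ∧ ExpAt S E (S.add S.one S.one) x' p ∧
    ∃ u v : K.M, K.lt v (e.j p) ∧
      c = K.add (K.add (K.mul u (K.add (e.j p) (e.j p))) (e.j p)) v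

/-! ## The second-order restricted ultrapower -/

/-- `A` is cofinal (unbounded) in `S`. -/
def Cofinal (S : Str) (A : Set S.M) : Prop := ∀ b : S.M, ∃ x ∈ A, S.lt b x

/-- The pairing term `⟨x, y⟩ = (x + y)·(x + y) + x`. -/
def pairS (S : Str) (x y : S.M) : S.M := S.add (S.mul (S.add x y) (S.add x y)) x

/-- The graph of `f : M → M`, coded as a subset of `M` via pairing. -/
def graphOf (S : Str) (f : S.M → S.M) : Set S.M := {m | ∃ x, m = pairS S x (f x)}

/-- `f` is a total function `M → M` lying in the second-order universe `X`
(its coded graph belongs to `X`).  The collection of such `f` is the class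
`ℱ` of the restricted ultrapower. -/
def FuncIn (S : Str) (X : Set (Set S.M)) (f : S.M → S.M) : Prop := graphOf S f ∈ X

/-- `U` is an ultrafilter on the Boolean algebra `X`, all of whose elements
are cofinal in `M`. -/
structure UltraOn (S : Str) (X U : Set (Set S.M)) : Prop where
  subset : U ⊆ X
  univ_mem : Set.univ ∈ U
  empty_not_mem : ∅ ∉ U
  inter_mem : ∀ A ∈ U, ∀ B ∈ U, A ∩ B ∈ U
  superset_mem : ∀ A ∈ U, ∀ B ∈ X, A ⊆ B → B ∈ U
  ultra : ∀ A ∈ X, A ∈ U ∨ Aᶜ ∈ U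
  cofinal : ∀ A ∈ U, Cofinal S A

/-- A realization of the second-order restricted ultrapower `ℱ/𝒰` of `S`
with respect to the second-order universe `X` and the ultrafilter `U`:
a structure `K` whose elements are exactly the classes `cls f hf = [f]` of
total functions `f ∈ ℱ`, where `[f] = [g]` iff `f = g` on a set in `U`, with
pointwise arithmetic operations, order decided by `U`, and the inherited
second-order membership relation `memK` serving as the second-order expansion. -/
structure RUP (S : Str) (X U : Set (Set S.M)) : Type 1 where
  K : Str
  cls : (f : S.M → S.M) → FuncIn S X f → K.M
  memK : K.M → Set S.M → Prop
  const_in : ∀ a : S.M, FuncIn S X (fun _ => a)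
  surj : ∀ b : K.M, ∃ (f : S.M → S.M) (hf : FuncIn S X f), cls f hf = b
  eq_iff : ∀ (f : S.M → S.M) (hf : FuncIn S X f) (g : S.M → S.M) (hg : FuncIn S X g),
      (cls f hf = cls g hg) ↔ {i : S.M | f i = g i} ∈ U
  lt_iff : ∀ (f : S.M → S.M) (hf : FuncIn S X f) (g : S.M → S.M) (hg : FuncIn S X g),
      K.lt (cls f hf) (cls g hg) ↔ {i : S.M | S.lt (f i) (g i)} ∈ U
  zero_eq : K.zero = cls (fun _ => S.zero) (const_in S.zero)
  one_eq : K.one = cls (fun _ => S.one) (const_in S.one)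
  add_eq : ∀ (f : S.M → S.M) (hf : FuncIn S X f) (g : S.M → S.M) (hg : FuncIn S X g)
      (h : S.M → S.M) (hh : FuncIn S X h), (∀ i, h i = S.add (f i) (g i)) →
      K.add (cls f hf) (cls g hg) = cls h hh
  mul_eq : ∀ (f : S.M → S.M) (hf : FuncIn S X f) (g : S.M → S.M) (hg : FuncIn S X g)
      (h : S.M → S.M) (hh : FuncIn S X h), (∀ i, h i = S.mul (f i) (g i)) →
      K.mul (cls f hf) (cls g hg) = cls h hh
  mem_iff : ∀ (f : S.M → S.M) (hf : FuncIn S X f) (A : Set S.M), A ∈ X →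
      (memK (cls f hf) A ↔ {i : S.M | f i ∈ A} ∈ U)

/-- The canonical embedding `M → ℱ/𝒰` via constant functions. -/
def RUP.emb {S : Str} {X U : Set (Set S.M)} (R : RUP S X U) (a : S.M) : R.K.M :=
  R.cls (fun _ => a) (R.const_in a)

/-- The subset of `ℱ/𝒰` induced by `A ⊆ M`. -/
def RUP.setImg {S : Str} {X U : Set (Set S.M)} (R : RUP S X U) (A : Set S.M) :
    Set R.K.M := {b | R.memK b A}

/-- The second-order part of the expanded ultrapower `(ℱ/𝒰, 𝒳)`:
the (injected) copy of `X`. -/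
def RUP.X2 {S : Str} {X U : Set (Set S.M)} (R : RUP S X U) : Set (Set R.K.M) :=
  (fun A => R.setImg A) '' X

end PaperArith

namespace PaperArith

/-! ## Renaming variables -/

/-- Renaming of variables in terms. -/
def Term.ren (f : ℕ → ℕ) : Term → Term
  | .var i => .var (f i)
  | .zero => .zero
  | .one => .one
  | .add t u => .add (t.ren f) (u.ren f)
  | .mul t u => .mul (t.ren f) (u.ren f)

/-- Capture-avoiding renaming of the free number variables of a formula along `f`.  The bound
variables become `2 * N + 1`, `2 * (N + 1) + 1`, …, according to their depth. -/
def Fml.ren : Fml → (ℕ → ℕ) → ℕ → Fml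
  | .eq t u, f, _ => .eq (t.ren f) (u.ren f)
  | .lt t u, f, _ => .lt (t.ren f) (u.ren f)
  | .mem t i, f, _ => .mem (t.ren f) i
  | .not φ, f, N => .not (φ.ren f N)
  | .and φ ψ, f, N => .and (φ.ren f N) (ψ.ren f N)
  | .or φ ψ, f, N => .or (φ.ren f N) (ψ.ren f N)
  | .imp φ ψ, f, N => .imp (φ.ren f N) (ψ.ren f N)
  | .all x φ, f, N => .all (2 * N + 1) (φ.ren (upd f x (2 * N + 1)) (N + 1))
  | .ex x φ, f, N => .ex (2 * N + 1) (φ.ren (upd f x (2 * N + 1)) (N + 1))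
  | .ball x t φ, f, N => .ball (2 * N + 1) (t.ren f) (φ.ren (upd f x (2 * N + 1)) (N + 1))
  | .bex x t φ, f, N => .bex (2 * N + 1) (t.ren f) (φ.ren (upd f x (2 * N + 1)) (N + 1))
  | .sall i φ, f, N => .sall i (φ.ren f N)
  | .sex i φ, f, N => .sex i (φ.ren f N)

theorem tval_ren (S : Str) (f : ℕ → ℕ) (v : ℕ → S.M) (t : Term) :
    tval S v (t.ren f) = tval S (v ∘ f) t := by
  induction t with
  | var i => rfl
  | zero => rfl
  | one => rfl
  | add t u ht hu => simp [Term.ren, tval, ht, hu]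
  | mul t u ht hu => simp [Term.ren, tval, ht, hu]

theorem upd_comp_upd {α : Type} {f : ℕ → ℕ} {y : ℕ} (hf : ∀ i, f i ≠ y) (v : ℕ → α) (x : ℕ)
    (m : α) : upd v y m ∘ upd f x y = upd (v ∘ f) x m := by
  funext i
  by_cases hi : i = x <;> simp [upd, hi, hf]

theorem upd_fresh {f : ℕ → ℕ} {N : ℕ} (hf : ∀ i, ∀ k ≥ N, f i ≠ 2 * k + 1) (x : ℕ) :
    ∀ i, ∀ k ≥ N + 1, upd f x (2 * N + 1) i ≠ 2 * k + 1 := by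
  intro i k hk
  by_cases hi : i = x
  · simp only [upd, hi, if_true]; omega
  · simpa only [upd, hi, if_false] using hf i k (by omega)

theorem sat_ren (S : Str) (X : Set (Set S.M)) (φ : Fml) : ∀ (f : ℕ → ℕ) (N : ℕ) (v : ℕ → S.M)
    (w : ℕ → Set S.M), (∀ i, ∀ k ≥ N, f i ≠ 2 * k + 1) →
    (Sat S X v w (φ.ren f N) ↔ Sat S X (v ∘ f) w φ) := by
  induction φ with
  | eq t u => intro f N v w _; simp [Fml.ren, Sat, tval_ren]
  | lt t u => intro f N v w _; simp [Fml.ren, Sat, tval_ren]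
  | mem t i => intro f N v w _; simp [Fml.ren, Sat, tval_ren]
  | not φ ih => intro f N v w hf; simp [Fml.ren, Sat, ih f N v w hf]
  | and φ ψ ih ih' => intro f N v w hf; simp [Fml.ren, Sat, ih f N v w hf, ih' f N v w hf]
  | or φ ψ ih ih' => intro f N v w hf; simp [Fml.ren, Sat, ih f N v w hf, ih' f N v w hf]
  | imp φ ψ ih ih' => intro f N v w hf; simp [Fml.ren, Sat, ih f N v w hf, ih' f N v w hf]
  | all x φ ih =>
    intro f N v w hf
    simp [Fml.ren, Sat, ih _ _ _ _ (upd_fresh hf x), upd_comp_upd (fun i => hf i N le_rfl)]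
  | ex x φ ih =>
    intro f N v w hf
    simp [Fml.ren, Sat, ih _ _ _ _ (upd_fresh hf x), upd_comp_upd (fun i => hf i N le_rfl)]
  | ball x t φ ih =>
    intro f N v w hf
    simp [Fml.ren, Sat, ih _ _ _ _ (upd_fresh hf x), upd_comp_upd (fun i => hf i N le_rfl),
      tval_ren]
  | bex x t φ ih =>
    intro f N v w hf
    simp [Fml.ren, Sat, ih _ _ _ _ (upd_fresh hf x), upd_comp_upd (fun i => hf i N le_rfl),
      tval_ren]
  | sall i φ ih => intro f N v w hf; simp [Fml.ren, Sat, ih _ _ _ _ hf]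
  | sex i φ ih => intro f N v w hf; simp [Fml.ren, Sat, ih _ _ _ _ hf]

theorem Delta0.ren {φ : Fml} (h : Delta0 φ) : ∀ f N, Delta0 (φ.ren f N) := by
  induction h with
  | eq t u => intro f N; exact .eq _ _
  | lt t u => intro f N; exact .lt _ _
  | not _ ih => intro f N; exact .not (ih f N)
  | and _ _ ih ih' => intro f N; exact .and (ih f N) (ih' f N)
  | or _ _ ih ih' => intro f N; exact .or (ih f N) (ih' f N)
  | imp _ _ ih ih' => intro f N; exact .imp (ih f N) (ih' f N)
  | ball x t _ ih => intro f N; exact .ball _ _ (ih _ _)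
  | bex x t _ ih => intro f N; exact .bex _ _ (ih _ _)

/-- Simultaneous induction on the classes `Σₖ` and `Πₖ`. -/
theorem isSigma_isPi_induction {p q : ℕ → Fml → Prop}
    (h0 : ∀ k φ, Delta0 φ → p k φ ∧ q k φ) (ofPi : ∀ k φ, q k φ → p (k + 1) φ)
    (ex : ∀ x k φ, p (k + 1) φ → p (k + 1) (.ex x φ)) (ofSigma : ∀ k φ, p k φ → q (k + 1) φ)
    (all : ∀ x k φ, q (k + 1) φ → q (k + 1) (.all x φ)) :
    (∀ k φ, IsSigma k φ → p k φ) ∧ ∀ k φ, IsPi k φ → q k φ :=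
  ⟨fun _ _ h => IsSigma.rec (motive_1 := fun k φ _ => p k φ) (motive_2 := fun k φ _ => q k φ)
      (fun h => (h0 _ _ h).1) (fun _ => ofPi _ _) (fun x _ _ _ => ex x _ _)
      (fun h => (h0 _ _ h).2) (fun _ => ofSigma _ _) (fun x _ _ _ => all x _ _) h,
    fun _ _ h => IsPi.rec (motive_1 := fun k φ _ => p k φ) (motive_2 := fun k φ _ => q k φ)
      (fun h => (h0 _ _ h).1) (fun _ => ofPi _ _) (fun x _ _ _ => ex x _ _)
      (fun h => (h0 _ _ h).2) (fun _ => ofSigma _ _) (fun x _ _ _ => all x _ _) h⟩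

/-- Induction on `Σₖ` formulas with `Πₖ` formulas as atoms. -/
theorem IsSigma.induction {p : ℕ → Fml → Prop}
    (h0 : ∀ k φ, Delta0 φ → p k φ) (ofPi : ∀ k φ, IsPi k φ → p (k + 1) φ)
    (ex : ∀ x k φ, p (k + 1) φ → p (k + 1) (.ex x φ)) {k : ℕ} {φ : Fml} (h : IsSigma k φ) :
    p k φ :=
  ((isSigma_isPi_induction (p := fun k φ => IsSigma k φ ∧ p k φ) (q := IsPi)
    (fun k φ h => ⟨⟨.delta0 h, h0 k φ h⟩, .delta0 h⟩) (fun k φ h => ⟨.ofPi h, ofPi k φ h⟩)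
    (fun x k φ h => ⟨.ex x h.1, ex x k φ h.2⟩) (fun _ _ h => .ofSigma h.1)
    (fun x _ _ h => .all x h)).1 k φ h).2

theorem isSigma_isPi_ren :
    (∀ k φ, IsSigma k φ → ∀ f N, IsSigma k (φ.ren f N)) ∧
      ∀ k φ, IsPi k φ → ∀ f N, IsPi k (φ.ren f N) :=
  isSigma_isPi_induction (p := fun k φ => ∀ f N, IsSigma k (φ.ren f N))
    (q := fun k φ => ∀ f N, IsPi k (φ.ren f N))
    (fun _ _ h => ⟨fun f N => .delta0 (h.ren f N), fun f N => .delta0 (h.ren f N)⟩)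
    (fun _ _ ih f N => .ofPi (ih f N)) (fun _ _ _ ih _ _ => .ex _ (ih _ _))
    (fun _ _ ih f N => .ofSigma (ih f N)) (fun _ _ _ ih _ _ => .all _ (ih _ _))

theorem IsSigma.ren {k : ℕ} {φ : Fml} (h : IsSigma k φ) (f : ℕ → ℕ) (N : ℕ) :
    IsSigma k (φ.ren f N) := isSigma_isPi_ren.1 k φ h f N

theorem IsPi.ren {k : ℕ} {φ : Fml} (h : IsPi k φ) (f : ℕ → ℕ) (N : ℕ) :
    IsPi k (φ.ren f N) := isSigma_isPi_ren.2 k φ h f N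

theorem tval_support (S : Str) (t : Term) : ∃ N, ∀ v v' : ℕ → S.M, (∀ i < N, v i = v' i) →
    tval S v t = tval S v' t := by
  induction t with
  | var i => exact ⟨i + 1, fun v v' h => h i (by omega)⟩
  | zero => exact ⟨0, fun _ _ _ => rfl⟩
  | one => exact ⟨0, fun _ _ _ => rfl⟩
  | add t u ht hu =>
    obtain ⟨N, hN⟩ := ht
    obtain ⟨N', hN'⟩ := hu
    refine ⟨max N N', fun v v' h => ?_⟩
    simp only [tval]
    rw [hN v v' fun i hi => h i (by omega), hN' v v' fun i hi => h i (by omega)]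
  | mul t u ht hu =>
    obtain ⟨N, hN⟩ := ht
    obtain ⟨N', hN'⟩ := hu
    refine ⟨max N N', fun v v' h => ?_⟩
    simp only [tval]
    rw [hN v v' fun i hi => h i (by omega), hN' v v' fun i hi => h i (by omega)]

theorem upd_eq_of_lt {α : Type} {v v' : ℕ → α} {N : ℕ} (h : ∀ i < N, v i = v' i) (x : ℕ) (m : α) :
    ∀ i < N, upd v x m i = upd v' x m i := by
  intro i hi
  simp [upd, h i hi]

theorem sat0_support (S : Str) {φ : Fml} (hφ : Delta0 φ) : ∃ N, ∀ v v' : ℕ → S.M,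
    (∀ i < N, v i = v' i) → (Sat0 S v φ ↔ Sat0 S v' φ) := by
  unfold Sat0
  induction hφ with
  | eq t u =>
    obtain ⟨N, hN⟩ := tval_support S t
    obtain ⟨N', hN'⟩ := tval_support S u
    refine ⟨max N N', fun v v' h => ?_⟩
    simp only [Sat]
    rw [hN v v' fun i hi => h i (by omega), hN' v v' fun i hi => h i (by omega)]
  | lt t u =>
    obtain ⟨N, hN⟩ := tval_support S t
    obtain ⟨N', hN'⟩ := tval_support S u
    refine ⟨max N N', fun v v' h => ?_⟩
    simp only [Sat]
    rw [hN v v' fun i hi => h i (by omega), hN' v v' fun i hi => h i (by omega)]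
  | not _ ih =>
    obtain ⟨N, hN⟩ := ih
    exact ⟨N, fun v v' h => not_congr (hN v v' h)⟩
  | and _ _ ih ih' =>
    obtain ⟨N, hN⟩ := ih
    obtain ⟨N', hN'⟩ := ih'
    exact ⟨max N N', fun v v' h => and_congr (hN v v' fun i hi => h i (by omega))
      (hN' v v' fun i hi => h i (by omega))⟩
  | or _ _ ih ih' =>
    obtain ⟨N, hN⟩ := ih
    obtain ⟨N', hN'⟩ := ih'
    exact ⟨max N N', fun v v' h => or_congr (hN v v' fun i hi => h i (by omega))
      (hN' v v' fun i hi => h i (by omega))⟩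
  | imp _ _ ih ih' =>
    obtain ⟨N, hN⟩ := ih
    obtain ⟨N', hN'⟩ := ih'
    exact ⟨max N N', fun v v' h => imp_congr (hN v v' fun i hi => h i (by omega))
      (hN' v v' fun i hi => h i (by omega))⟩
  | ball x t _ ih =>
    obtain ⟨N, hN⟩ := tval_support S t
    obtain ⟨N', hN'⟩ := ih
    refine ⟨max N N', fun v v' h => ?_⟩
    simp only [Sat]
    rw [hN v v' fun i hi => h i (by omega)]
    exact forall_congr' fun m => imp_congr_right fun _ =>
      hN' _ _ (upd_eq_of_lt (fun i hi => h i (by omega)) x m)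
  | bex x t _ ih =>
    obtain ⟨N, hN⟩ := tval_support S t
    obtain ⟨N', hN'⟩ := ih
    refine ⟨max N N', fun v v' h => ?_⟩
    simp only [Sat]
    rw [hN v v' fun i hi => h i (by omega)]
    exact exists_congr fun m => and_congr_right fun _ =>
      hN' _ _ (upd_eq_of_lt (fun i hi => h i (by omega)) x m)

/-! ## Countability of the syntax -/

/-- A numerical code of a term. -/
def Term.code : Term → ℕ
  | .var i => Nat.pair 0 i
  | .zero => Nat.pair 1 0
  | .one => Nat.pair 2 0
  | .add t u => Nat.pair 3 (Nat.pair t.code u.code)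
  | .mul t u => Nat.pair 4 (Nat.pair t.code u.code)

theorem Term.code_injective : Function.Injective Term.code := by
  intro t
  induction t with
  | var i => intro u h; cases u <;> simp_all [Term.code]
  | zero => intro u h; cases u <;> simp_all [Term.code]
  | one => intro u h; cases u <;> simp_all [Term.code]
  | add t u iht ihu =>
    intro w h
    cases w <;> simp [Term.code] at h
    rw [iht h.1, ihu h.2]
  | mul t u iht ihu =>
    intro w h
    cases w <;> simp [Term.code] at h
    rw [iht h.1, ihu h.2]

/-- A numerical code of a formula, injective on bounded formulas. -/
def Fml.code : Fml → ℕ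
  | .eq t u => Nat.pair 0 (Nat.pair t.code u.code)
  | .lt t u => Nat.pair 1 (Nat.pair t.code u.code)
  | .not φ => Nat.pair 2 φ.code
  | .and φ ψ => Nat.pair 3 (Nat.pair φ.code ψ.code)
  | .or φ ψ => Nat.pair 4 (Nat.pair φ.code ψ.code)
  | .imp φ ψ => Nat.pair 5 (Nat.pair φ.code ψ.code)
  | .ball x t φ => Nat.pair 6 (Nat.pair x (Nat.pair t.code φ.code))
  | .bex x t φ => Nat.pair 7 (Nat.pair x (Nat.pair t.code φ.code))
  | _ => 0

theorem Fml.code_injOn : Set.InjOn Fml.code {φ | Delta0 φ} := by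
  intro φ (hφ : Delta0 φ)
  induction hφ with
  | eq t u =>
    intro χ hχ h
    cases hχ <;> simp [Fml.code] at h
    rw [Term.code_injective h.1, Term.code_injective h.2]
  | lt t u =>
    intro χ hχ h
    cases hχ <;> simp [Fml.code] at h
    rw [Term.code_injective h.1, Term.code_injective h.2]
  | not _ ih =>
    intro χ hχ h
    cases hχ <;> simp [Fml.code] at h
    rw [ih ‹_› h]
  | and _ _ ih ih' =>
    intro χ hχ h
    cases hχ <;> simp [Fml.code] at h
    rw [ih ‹_› h.1, ih' ‹_› h.2]
  | or _ _ ih ih' =>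
    intro χ hχ h
    cases hχ <;> simp [Fml.code] at h
    rw [ih ‹_› h.1, ih' ‹_› h.2]
  | imp _ _ ih ih' =>
    intro χ hχ h
    cases hχ <;> simp [Fml.code] at h
    rw [ih ‹_› h.1, ih' ‹_› h.2]
  | ball x t _ ih =>
    intro χ hχ h
    cases hχ <;> simp [Fml.code] at h
    rw [h.1, Term.code_injective h.2.1, ih ‹_› h.2.2]
  | bex x t _ ih =>
    intro χ hχ h
    cases hχ <;> simp [Fml.code] at h
    rw [h.1, Term.code_injective h.2.1, ih ‹_› h.2.2]

theorem countable_delta0 : {φ | Delta0 φ}.Countable :=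
  Set.MapsTo.countable_of_injOn (Set.mapsTo_univ Fml.code _) Fml.code_injOn Set.countable_univ

/-! ## Order in models of `PA⁻` -/

namespace PAminus

theorem not_lt_zero {S : Str} (hp : PAminus S) (a : S.M) : ¬ S.lt a S.zero := by
  intro h
  rcases hp.zero_le a with rfl | h'
  · exact hp.lt_irrefl _ h
  · exact hp.lt_irrefl _ (hp.lt_trans _ _ _ h h')

theorem zero_add {S : Str} (hp : PAminus S) (a : S.M) : S.add S.zero a = a := by
  rw [hp.add_comm, hp.add_zero]

theorem lt_succ_self {S : Str} (hp : PAminus S) (a : S.M) : S.lt a (S.add a S.one) := by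
  have h := hp.add_lt_add _ _ a hp.zero_lt_one
  rwa [hp.zero_add, hp.add_comm] at h

theorem lt_succ_iff {S : Str} (hp : PAminus S) (a b : S.M) :
    S.lt a (S.add b S.one) ↔ S.lt a b ∨ a = b := by
  constructor
  · intro h
    rcases hp.lt_total a b with h' | h' | h'
    · exact .inl h'
    · exact .inr h'
    · rcases hp.discrete _ _ h' with h'' | h''
      · exact absurd (h'' ▸ h) (hp.lt_irrefl _)
      · exact absurd (hp.lt_trans _ _ _ h h'') (hp.lt_irrefl _)
  · rintro (h | rfl)
    · exact hp.lt_trans _ _ _ h (hp.lt_succ_self b)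
    · exact hp.lt_succ_self a

theorem eq_zero_or_succ {S : Str} (hp : PAminus S) (a : S.M) :
    a = S.zero ∨ ∃ b, a = S.add b S.one := by
  rcases hp.zero_le a with h | h
  · exact .inl h
  · obtain ⟨b, hb⟩ := hp.pred a h
    exact .inr ⟨b, hb.symm⟩

theorem exists_gt_gt {S : Str} (hp : PAminus S) (a b : S.M) : ∃ c, S.lt a c ∧ S.lt b c := by
  rcases hp.lt_total a b with h | rfl | h
  · exact ⟨_, hp.lt_trans _ _ _ h (hp.lt_succ_self b), hp.lt_succ_self b⟩
  · exact ⟨_, hp.lt_succ_self a, hp.lt_succ_self a⟩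
  · exact ⟨_, hp.lt_succ_self a, hp.lt_trans _ _ _ h (hp.lt_succ_self a)⟩

theorem add_right_cancel {S : Str} (hp : PAminus S) {a b c : S.M}
    (h : S.add a c = S.add b c) : a = b := by
  rcases hp.lt_total a b with h' | h' | h'
  · exact absurd (h ▸ hp.add_lt_add _ _ c h') (hp.lt_irrefl _)
  · exact h'
  · exact absurd (h ▸ hp.add_lt_add _ _ c h') (hp.lt_irrefl _)

end PAminus

/-! ## The boldface arithmetic hierarchy on predicates of valuations -/

/-- Prepend a value to a valuation. -/
def cons {α : Type} (m : α) (v : ℕ → α) : ℕ → α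
  | 0 => m
  | i + 1 => v i

/-- The value of an atom, which is either a variable or a parameter. -/
def ev {α : Type} (v : ℕ → α) : ℕ ⊕ α → α := Sum.elim v id

/-- The valuation obtained from `v` by substituting atoms for the variables. -/
def inst {α : Type} (ρ : ℕ → ℕ ⊕ α) (v : ℕ → α) : ℕ → α := fun i => ev v (ρ i)

/-- Composition of substitutions. -/
def substComp {α : Type} (ρ ρ' : ℕ → ℕ ⊕ α) : ℕ → ℕ ⊕ α := fun i => Sum.elim ρ .inr (ρ' i)

theorem inst_substComp {α : Type} (ρ ρ' : ℕ → ℕ ⊕ α) (v : ℕ → α) :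
    inst (substComp ρ ρ') v = inst ρ' (inst ρ v) := by
  funext i
  simp only [inst, substComp]
  cases ρ' i <;> rfl

/-- Renaming that moves the first variable of `cons m v` to a variable that can be quantified. -/
theorem exists_bind {S : Str} (ρ : ℕ → ℕ ⊕ S.M) (x : ℕ ⊕ S.M) :
    ∃ (f : ℕ → ℕ) (ρ' : ℕ → ℕ ⊕ S.M), (∀ v, inst ρ' v 1 = ev v x) ∧ ∀ φ v m,
      (Sat0 S (upd (inst ρ' v) 0 m) (φ.ren f 0) ↔ Sat0 S (inst ρ (cons m v)) φ) := by
  let f : ℕ → ℕ := fun i => match ρ i with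
    | .inl 0 => 0
    | _ => 2 * (i + 1)
  let ρ' : ℕ → ℕ ⊕ S.M := fun j => if j = 1 then x else match ρ (j / 2 - 1) with
    | .inl k => .inl (k - 1)
    | .inr a => .inr a
  refine ⟨f, ρ', fun v => by simp [inst, ρ'], fun φ v m => ?_⟩
  have hf : ∀ i, ∀ k ≥ 0, f i ≠ 2 * k + 1 := by
    intro i k _
    simp only [f]
    split <;> omega
  unfold Sat0
  rw [sat_ren S _ φ f 0 _ _ hf]
  have : upd (inst ρ' v) 0 m ∘ f = inst ρ (cons m v) := by
    funext i
    rcases h : ρ i with (_ | k) | a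
    · have hi : f i = 0 := by simp only [f, h]
      simp [hi, h, upd, inst, ev, cons]
    · have hi : f i = 2 * (i + 1) := by simp only [f, h]
      have : ρ' (2 * (i + 1)) = .inl k := by
        simp only [ρ']
        rw [if_neg (by omega), show 2 * (i + 1) / 2 - 1 = i by omega, h]
        rfl
      simp [hi, h, upd, inst, this, ev, cons]
    · have hi : f i = 2 * (i + 1) := by simp only [f, h]
      have : ρ' (2 * (i + 1)) = .inr a := by
        simp only [ρ']
        rw [if_neg (by omega), show 2 * (i + 1) / 2 - 1 = i by omega, h]
      simp [hi, h, upd, inst, this, ev]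
  rw [this]

/-- The predicates on valuations definable by a `Σₖ` formula with parameters. -/
def SigmaPred (S : Str) : ℕ → ((ℕ → S.M) → Prop) → Prop
  | 0, P => ∃ φ, Delta0 φ ∧ ∃ ρ, ∀ v, P v ↔ Sat0 S (inst ρ v) φ
  | k + 1, P => ∃ Q, SigmaPred S k Q ∧ ∀ v, P v ↔ ∃ m, ¬ Q (cons m v)

namespace SigmaPred

theorem congr {S : Str} {k : ℕ} {P Q : (ℕ → S.M) → Prop} (hP : SigmaPred S k P)
    (h : ∀ v, Q v ↔ P v) : SigmaPred S k Q := by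
  rwa [show Q = P from funext fun v => propext (h v)]

theorem subst {S : Str} {k : ℕ} {P : (ℕ → S.M) → Prop} (hP : SigmaPred S k P)
    (ρ : ℕ → ℕ ⊕ S.M) : SigmaPred S k (fun v => P (inst ρ v)) := by
  induction k generalizing P ρ with
  | zero =>
    obtain ⟨φ, hφ, ρ', h⟩ := hP
    exact ⟨φ, hφ, substComp ρ ρ', fun v => by rw [inst_substComp]; exact h _⟩
  | succ k ih =>
    obtain ⟨Q, hQ, h⟩ := hP
    let ρ' : ℕ → ℕ ⊕ S.M := cons (.inl 0) fun i => Sum.map Nat.succ id (ρ i)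
    refine ⟨_, ih hQ ρ', fun v => ?_⟩
    have : ∀ m, inst ρ' (cons m v) = cons m (inst ρ v) := by
      intro m
      funext i
      rcases i with _ | i
      · rfl
      · simp only [inst, ρ', cons]
        cases ρ i <;> rfl
    simp only [h, this]

theorem zero_eq {S : Str} (x y : ℕ ⊕ S.M) : SigmaPred S 0 (fun v => ev v x = ev v y) :=
  ⟨.eq (.var 0) (.var 1), .eq _ _, cons x (cons y fun _ => x), fun _ => Iff.rfl⟩

theorem zero_lt {S : Str} (x y : ℕ ⊕ S.M) : SigmaPred S 0 (fun v => S.lt (ev v x) (ev v y)) :=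
  ⟨.lt (.var 0) (.var 1), .lt _ _, cons x (cons y fun _ => x), fun _ => Iff.rfl⟩

theorem zero_add {S : Str} (x y z : ℕ ⊕ S.M) :
    SigmaPred S 0 (fun v => S.add (ev v x) (ev v y) = ev v z) :=
  ⟨.eq (.add (.var 0) (.var 1)) (.var 2), .eq _ _, cons x (cons y (cons z fun _ => x)),
    fun _ => Iff.rfl⟩

theorem zero_mul {S : Str} (x y z : ℕ ⊕ S.M) :
    SigmaPred S 0 (fun v => S.mul (ev v x) (ev v y) = ev v z) :=
  ⟨.eq (.mul (.var 0) (.var 1)) (.var 2), .eq _ _, cons x (cons y (cons z fun _ => x)),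
    fun _ => Iff.rfl⟩

theorem zero_not {S : Str} {P : (ℕ → S.M) → Prop} (hP : SigmaPred S 0 P) :
    SigmaPred S 0 (fun v => ¬ P v) := by
  obtain ⟨φ, hφ, ρ, h⟩ := hP
  exact ⟨.not φ, hφ.not, ρ, fun v => not_congr (h v)⟩

theorem succ_of_not {S : Str} {k : ℕ} {P : (ℕ → S.M) → Prop}
    (hP : SigmaPred S k (fun v => ¬ P v)) : SigmaPred S (k + 1) P :=
  ⟨_, hP.subst fun i => .inl (i + 1), fun v => by
    have : ∀ m : S.M, inst (fun i => .inl (i + 1)) (cons m v) = v := fun m => rfl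
    simp only [this, not_not, exists_const_iff]
    exact ⟨fun h => ⟨⟨S.zero⟩, h⟩, fun h => h.2⟩⟩

theorem succ {S : Str} {k : ℕ} {P : (ℕ → S.M) → Prop} (hP : SigmaPred S k P) :
    SigmaPred S (k + 1) P := by
  induction k generalizing P with
  | zero => exact succ_of_not hP.zero_not
  | succ k ih =>
    obtain ⟨Q, hQ, h⟩ := hP
    exact ⟨Q, ih hQ, h⟩

theorem mono {S : Str} {k l : ℕ} (hkl : k ≤ l) {P : (ℕ → S.M) → Prop} (hP : SigmaPred S k P) :
    SigmaPred S l P := by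
  induction hkl with
  | refl => exact hP
  | step _ ih => exact ih.succ

theorem zero_and {S : Str} {P Q : (ℕ → S.M) → Prop} (hP : SigmaPred S 0 P)
    (hQ : SigmaPred S 0 Q) : SigmaPred S 0 (fun v => P v ∧ Q v) := by
  obtain ⟨φ, hφ, ρ, h⟩ := hP
  obtain ⟨ψ, hψ, ρ', h'⟩ := hQ
  refine ⟨.and (φ.ren (fun i => 4 * i) 0) (ψ.ren (fun i => 4 * i + 2) 0),
    .and (hφ.ren _ _) (hψ.ren _ _), fun j => if j % 4 = 0 then ρ (j / 4) else ρ' (j / 4),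
    fun v => ?_⟩
  beta_reduce
  rw [h, h']
  unfold Sat0
  simp only [Sat]
  rw [sat_ren _ _ _ _ _ _ _ fun i k _ => by omega, sat_ren _ _ _ _ _ _ _ fun i k _ => by omega]
  refine and_congr (iff_of_eq ?_) (iff_of_eq ?_)
  · congr 1
    funext i
    simp [inst]
  · congr 1
    funext i
    simp only [inst, Function.comp]
    rw [if_neg (by omega), show (4 * i + 2) / 4 = i by omega]

theorem zero_bex {S : Str} (x : ℕ ⊕ S.M) {P : (ℕ → S.M) → Prop} (hP : SigmaPred S 0 P) :
    SigmaPred S 0 (fun v => ∃ m, S.lt m (ev v x) ∧ P (cons m v)) := by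
  obtain ⟨φ, hφ, ρ, h⟩ := hP
  obtain ⟨f, ρ', hx, hρ'⟩ := exists_bind ρ x
  refine ⟨.bex 0 (.var 1) (φ.ren f 0), .bex _ _ (hφ.ren _ _), ρ', fun v => ?_⟩
  refine exists_congr fun m => ?_
  rw [h, ← hρ', ← hx]
  rfl

theorem exists_formula {S : Str} {k : ℕ} {P : (ℕ → S.M) → Prop} (hP : SigmaPred S k P) :
    (∃ φ, IsSigma k φ ∧ ∃ ρ, ∀ v, P v ↔ Sat0 S (inst ρ v) φ) ∧
      ∃ φ, IsPi k φ ∧ ∃ ρ, ∀ v, ¬ P v ↔ Sat0 S (inst ρ v) φ := by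
  induction k generalizing P with
  | zero =>
    obtain ⟨φ, hφ, ρ, h⟩ := hP
    exact ⟨⟨φ, .delta0 hφ, ρ, h⟩, .not φ, .delta0 hφ.not, ρ, fun v => not_congr (h v)⟩
  | succ k ih =>
    obtain ⟨Q, hQ, h⟩ := hP
    obtain ⟨⟨φ, hφ, ρ, hφQ⟩, ψ, hψ, ρ', hψQ⟩ := ih hQ
    constructor
    · obtain ⟨f, σ, -, hσ⟩ := exists_bind ρ' (.inl 0)
      refine ⟨.ex 0 (ψ.ren f 0), .ex _ (.ofPi (hψ.ren _ _)), σ, fun v => ?_⟩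
      rw [h]
      exact exists_congr fun m => by rw [hψQ, ← hσ]; rfl
    · obtain ⟨f, σ, -, hσ⟩ := exists_bind ρ (.inl 0)
      refine ⟨.all 0 (φ.ren f 0), .all _ (.ofSigma (hφ.ren _ _)), σ, fun v => ?_⟩
      rw [h]
      simp only [not_exists, not_not]
      exact forall_congr' fun m => by rw [hφQ, ← hσ]; rfl

theorem support {S : Str} {k : ℕ} {P : (ℕ → S.M) → Prop} (hP : SigmaPred S k P) :
    ∃ N, ∀ v v' : ℕ → S.M, (∀ i < N, v i = v' i) → (P v ↔ P v') := by
  induction k generalizing P with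
  | zero =>
    obtain ⟨φ, hφ, ρ, h⟩ := hP
    obtain ⟨N, hN⟩ := sat0_support S hφ
    refine ⟨∑ i ∈ Finset.range N, ((ρ i).elim Nat.succ fun _ => 0), fun v v' hv => ?_⟩
    rw [h, h]
    refine hN _ _ fun i hi => ?_
    have hle := Finset.single_le_sum (f := fun i => ((ρ i).elim Nat.succ fun _ => 0))
      (fun i _ => Nat.zero_le _) (Finset.mem_range.2 hi)
    simp only [inst]
    rcases hρ : ρ i with j | a
    · simp only [hρ, Sum.elim_inl] at hle
      exact hv j (by omega)
    · rfl
  | succ k ih =>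
    obtain ⟨Q, hQ, h⟩ := hP
    obtain ⟨N, hN⟩ := ih hQ
    refine ⟨N, fun v v' hv => ?_⟩
    rw [h, h]
    refine exists_congr fun m => not_congr (hN _ _ fun i hi => ?_)
    rcases i with _ | i
    · rfl
    · exact hv i (by omega)

theorem countable {S : Str} (hc : Countable S.M) (k : ℕ) : {P | SigmaPred S k P}.Countable := by
  induction k with
  | zero =>
    let g : Fml × List (ℕ ⊕ S.M) → (ℕ → S.M) → Prop :=
      fun p v => Sat0 S (inst (fun i => p.2.getD i (.inl 0)) v) p.1
    refine ((countable_delta0.prod Set.countable_univ).image g).mono ?_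
    rintro P ⟨φ, hφ, ρ, h⟩
    obtain ⟨N, hN⟩ := sat0_support S hφ
    refine ⟨(φ, (List.range N).map ρ), ⟨hφ, trivial⟩, funext fun v => propext ?_⟩
    rw [h]
    refine hN _ _ fun i hi => ?_
    simp [inst, List.getD, hi]
  | succ k ih =>
    refine (ih.image fun Q v => ∃ m, ¬ Q (cons m v)).mono ?_
    rintro P ⟨Q, hQ, h⟩
    exact ⟨Q, hQ, funext fun v => propext (h v).symm⟩

end SigmaPred

/-! ## Closure properties of the hierarchy under induction -/

/-- Induction for all boldface `Σₖ` predicates. -/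
def IndPred (S : Str) (k : ℕ) : Prop :=
  ∀ P, SigmaPred S k P → ∀ v, P (cons S.zero v) →
    (∀ m, P (cons m v) → P (cons (S.add m S.one) v)) → ∀ m, P (cons m v)

theorem IndPred.mono {S : Str} {k l : ℕ} (h : IndPred S l) (hkl : k ≤ l) : IndPred S k :=
  fun P hP => h P (hP.mono hkl)

theorem ISigma.indPred {S : Str} {k : ℕ} (h : ISigma S k) : IndPred S k := by
  intro P hP v
  obtain ⟨φ, hφ, ρ, hφP⟩ := hP.exists_formula.1
  obtain ⟨f, ρ', -, hf⟩ := exists_bind ρ (.inl 0)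
  simp only [hφP, ← hf]
  exact h.2 _ (hφ.ren f 0) _ 0

/-- Closure of the boldface `Σₖ` predicates under the positive connectives and bounded
quantifiers. -/
structure SigmaClosed (S : Str) (k : ℕ) : Prop where
  and : ∀ {P Q : (ℕ → S.M) → Prop}, SigmaPred S k P → SigmaPred S k Q →
    SigmaPred S k (fun v => P v ∧ Q v)
  or : ∀ {P Q : (ℕ → S.M) → Prop}, SigmaPred S k P → SigmaPred S k Q →
    SigmaPred S k (fun v => P v ∨ Q v)
  bex : ∀ (x : ℕ ⊕ S.M) {P : (ℕ → S.M) → Prop}, SigmaPred S k P →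
    SigmaPred S k (fun v => ∃ m, S.lt m (ev v x) ∧ P (cons m v))
  ball : ∀ (x : ℕ ⊕ S.M) {P : (ℕ → S.M) → Prop}, SigmaPred S k P →
    SigmaPred S k (fun v => ∀ m, S.lt m (ev v x) → P (cons m v))

theorem sigmaClosed_zero (S : Str) : SigmaClosed S 0 where
  and := SigmaPred.zero_and
  or hP hQ := (hP.zero_not.zero_and hQ.zero_not).zero_not.congr fun v => by tauto
  bex := SigmaPred.zero_bex
  ball x P hP := (hP.zero_not.zero_bex x).zero_not.congr fun v => by simp

namespace SigmaClosed

theorem or_succ {S : Str} {k : ℕ} (hk : SigmaClosed S k) {P Q : (ℕ → S.M) → Prop}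
    (hP : SigmaPred S (k + 1) P) (hQ : SigmaPred S (k + 1) Q) :
    SigmaPred S (k + 1) (fun v => P v ∨ Q v) := by
  obtain ⟨P', hP', h⟩ := hP
  obtain ⟨Q', hQ', h'⟩ := hQ
  refine ⟨_, hk.and hP' hQ', fun v => ?_⟩
  simp only [h, h', not_and_or, exists_or]

theorem and_succ {S : Str} (hp : PAminus S) {k : ℕ} (hk : SigmaClosed S k)
    {P Q : (ℕ → S.M) → Prop} (hP : SigmaPred S (k + 1) P) (hQ : SigmaPred S (k + 1) Q) :
    SigmaPred S (k + 1) (fun v => P v ∧ Q v) := by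
  obtain ⟨P', hP', h⟩ := hP
  obtain ⟨Q', hQ', h'⟩ := hQ
  let ρ : ℕ → ℕ ⊕ S.M := cons (.inl 0) fun i => .inl (i + 2)
  have hρ : ∀ m w v, inst ρ (cons m (cons w v)) = cons m v := by
    intro m w v; funext i; rcases i with _ | i <;> rfl
  refine ⟨_, hk.or (hk.ball (.inl 0) (hP'.subst ρ)) (hk.ball (.inl 0) (hQ'.subst ρ)),
    fun v => ?_⟩
  simp only [h, h', hρ, ev, Sum.elim_inl, cons, not_or, not_forall, exists_prop]
  constructor
  · rintro ⟨⟨m, hm⟩, m', hm'⟩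
    obtain ⟨w, hw, hw'⟩ := hp.exists_gt_gt m m'
    exact ⟨w, ⟨m, hw, hm⟩, m', hw', hm'⟩
  · rintro ⟨w, ⟨m, -, hm⟩, m', -, hm'⟩
    exact ⟨⟨m, hm⟩, m', hm'⟩

theorem ex_succ {S : Str} (hp : PAminus S) {k : ℕ} (hk : SigmaClosed S k)
    {P : (ℕ → S.M) → Prop} (hP : SigmaPred S (k + 1) P) :
    SigmaPred S (k + 1) (fun v => ∃ m, P (cons m v)) := by
  obtain ⟨Q, hQ, h⟩ := hP
  let ρ : ℕ → ℕ ⊕ S.M := cons (.inl 0) (cons (.inl 1) fun i => .inl (i + 3))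
  have hρ : ∀ m y w v, inst ρ (cons m (cons y (cons w v))) = cons m (cons y v) := by
    intro m y w v; funext i; rcases i with _ | _ | i <;> rfl
  refine ⟨_, hk.ball (.inl 0) (hk.ball (.inl 1) (hQ.subst ρ)), fun v => ?_⟩
  simp only [h, hρ, ev, Sum.elim_inl, cons, not_forall, exists_prop]
  constructor
  · rintro ⟨y, m, hm⟩
    obtain ⟨w, hw, hw'⟩ := hp.exists_gt_gt y m
    exact ⟨w, y, hw, m, hw', hm⟩
  · rintro ⟨w, y, -, m, -, hm⟩
    exact ⟨y, m, hm⟩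

theorem bex_succ {S : Str} (hp : PAminus S) {k : ℕ} (hk : SigmaClosed S k) (x : ℕ ⊕ S.M)
    {P : (ℕ → S.M) → Prop} (hP : SigmaPred S (k + 1) P) :
    SigmaPred S (k + 1) (fun v => ∃ m, S.lt m (ev v x) ∧ P (cons m v)) := by
  have h0 : SigmaPred S 0 (fun v => S.lt (ev v (.inl 0)) (ev v (x.map Nat.succ id))) :=
    .zero_lt _ _
  refine (hk.ex_succ hp (hk.and_succ hp (h0.mono (Nat.zero_le _)) hP)).congr fun v => ?_
  have : ∀ m, ev (cons m v) (x.map Nat.succ id) = ev v x := by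
    intro m; cases x <;> rfl
  simp only [this]
  rfl

/-- Induction up to a bound. -/
theorem induction_le {S : Str} (hp : PAminus S) {k : ℕ} (hk : SigmaClosed S k)
    (hI : IndPred S (k + 1)) {P : (ℕ → S.M) → Prop} (hP : SigmaPred S (k + 1) P) {v : ℕ → S.M}
    {a : S.M} (h0 : P (cons S.zero v))
    (hs : ∀ m, S.lt m a → P (cons m v) → P (cons (S.add m S.one) v)) : P (cons a v) := by
  have hlt : SigmaPred S 0 (fun u => S.lt (ev u (.inr a)) (ev u (.inl 0))) := .zero_lt _ _
  have := hI _ (hk.or_succ hP (hlt.mono (Nat.zero_le _))) v (.inl h0) (fun m hm => ?_) a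
  · exact this.resolve_right (hp.lt_irrefl a)
  · change P _ ∨ S.lt a m at hm
    change P _ ∨ S.lt a (S.add m S.one)
    rw [hp.lt_succ_iff]
    rcases hp.lt_total m a with h | h | h
    · exact .inl (hs m h (hm.resolve_right fun h' => hp.lt_irrefl _ (hp.lt_trans _ _ _ h h')))
    · exact .inr (.inr h.symm)
    · exact .inr (.inl h)

theorem ball_succ {S : Str} (hp : PAminus S) {k : ℕ} (hk : SigmaClosed S k)
    (hI : IndPred S (k + 1)) (x : ℕ ⊕ S.M) {P : (ℕ → S.M) → Prop}
    (hP : SigmaPred S (k + 1) P) :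
    SigmaPred S (k + 1) (fun v => ∀ m, S.lt m (ev v x) → P (cons m v)) := by
  obtain ⟨Q, hQ, h⟩ := hP
  let ρ : ℕ → ℕ ⊕ S.M := cons (.inl 0) (cons (.inl 1) fun i => .inl (i + 4))
  have hρ : ∀ m y w z v, inst ρ (cons m (cons y (cons w (cons z v)))) = cons m (cons y v) := by
    intro m y w z v; funext i; rcases i with _ | _ | i <;> rfl
  let J : (ℕ → S.M) → Prop := fun u => ∃ w, ¬ ∃ y, S.lt y (ev (cons w u) (.inl 1)) ∧
    ∀ m, S.lt m (ev (cons y (cons w u)) (.inl 1)) → Q (inst ρ (cons m (cons y (cons w u))))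
  have hJ : SigmaPred S (k + 1) J :=
    ⟨_, hk.bex (.inl 1) (hk.ball (.inl 1) (hQ.subst ρ)), fun v => Iff.rfl⟩
  have hJ' : ∀ z v, J (cons z v) ↔
      ∃ w, ∀ y, S.lt y z → ∃ m, S.lt m w ∧ ¬ Q (cons m (cons y v)) := by
    intro z v
    simp only [J, hρ, ev, Sum.elim_inl, cons, not_forall, not_exists, not_and, exists_prop]
  refine (hJ.subst (cons x .inl)).congr fun v => ?_
  have : inst (cons x .inl) v = cons (ev v x) v := by
    funext i; rcases i with _ | i <;> rfl
  rw [this]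
  constructor
  · intro hv
    refine hk.induction_le hp hI hJ ?_ fun z hz hJz => ?_
    · exact (hJ' _ _).2 ⟨S.zero, fun y hy => absurd hy (hp.not_lt_zero y)⟩
    · obtain ⟨w, hw⟩ := (hJ' _ _).1 hJz
      obtain ⟨m, hm⟩ := (h _).1 (hv z hz)
      obtain ⟨w', hw', hmw'⟩ := hp.exists_gt_gt w m
      refine (hJ' _ _).2 ⟨w', fun y hy => ?_⟩
      rcases (hp.lt_succ_iff y z).1 hy with hy | rfl
      · obtain ⟨m', hm', hQm'⟩ := hw y hy
        exact ⟨m', hp.lt_trans _ _ _ hm' hw', hQm'⟩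
      · exact ⟨m, hmw', hm⟩
  · intro hv y hy
    obtain ⟨w, hw⟩ := (hJ' _ _).1 hv
    obtain ⟨m, -, hm⟩ := hw y hy
    exact (h _).2 ⟨m, hm⟩

end SigmaClosed

theorem IndPred.sigmaClosed {S : Str} (hp : PAminus S) {k : ℕ} (hI : IndPred S k) :
    SigmaClosed S k := by
  induction k with
  | zero => exact sigmaClosed_zero S
  | succ k ih =>
    have hk := ih (hI.mono k.le_succ)
    exact ⟨hk.and_succ hp, hk.or_succ, hk.bex_succ hp, hk.ball_succ hp hI⟩

/-- A valuation changed at `x`, as a substitution instance. -/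
theorem upd_eq_inst {α : Type} (v : ℕ → α) (x : ℕ) (m : α) :
    upd v x m = inst (fun i => if i = x then .inl 0 else .inl (i + 1)) (cons m v) := by
  funext i
  by_cases h : i = x <;> simp [upd, inst, ev, cons, h]

/-- A `Σₖ` predicate remains `Σₖ` after updating a renamed valuation. -/
theorem SigmaPred.rename_upd {S : Str} {k : ℕ} {P : (ℕ → S.M) → Prop}
    (hP : SigmaPred S k P) (σ : ℕ → ℕ) (x : ℕ) :
    SigmaPred S k fun v => P (upd (fun i => v (σ i + 1)) x (v 0)) :=
  (hP.subst fun i => if i = x then .inl 0 else .inl (σ i + 1)).congr fun v => by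
    rw [show upd (fun i => v (σ i + 1)) x (v 0) =
      inst (fun i => if i = x then .inl 0 else .inl (σ i + 1)) v by
        funext i; simp only [upd, inst]; split_ifs <;> rfl]

theorem sigmaPred_of_delta0 {S : Str} {φ : Fml} (h : Delta0 φ) :
    SigmaPred S 0 (fun v => Sat0 S v φ) :=
  ⟨φ, h, .inl, fun _ => Iff.rfl⟩

theorem sigmaPred_ex {S : Str} (hp : PAminus S) {k : ℕ} (hI : IndPred S k) {P : (ℕ → S.M) → Prop}
    (hP : SigmaPred S (k + 1) P) (x : ℕ) : SigmaPred S (k + 1) (fun v => ∃ m, P (upd v x m)) := by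
  simp only [upd_eq_inst]
  exact (hI.sigmaClosed hp).ex_succ hp (hP.subst _)

theorem sigmaPred_of_isSigma_isPi {S : Str} (hp : PAminus S) :
    (∀ k φ, IsSigma k φ → IndPred S k → SigmaPred S k fun v => Sat0 S v φ) ∧
      ∀ k φ, IsPi k φ → IndPred S k → SigmaPred S k fun v => ¬ Sat0 S v φ :=
  isSigma_isPi_induction (p := fun k φ => IndPred S k → SigmaPred S k fun v => Sat0 S v φ)
    (q := fun k φ => IndPred S k → SigmaPred S k fun v => ¬ Sat0 S v φ)
    (fun _ _ h => ⟨fun _ => (sigmaPred_of_delta0 h).mono (Nat.zero_le _),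
      fun _ => (sigmaPred_of_delta0 h).zero_not.mono (Nat.zero_le _)⟩)
    (fun _ _ ih hI => .succ_of_not (ih (hI.mono (Nat.le_succ _))))
    (fun x _ _ ih hI => sigmaPred_ex hp (hI.mono (Nat.le_succ _)) (ih hI) x)
    (fun _ _ ih hI => .succ_of_not ((ih (hI.mono (Nat.le_succ _))).congr fun _ => not_not))
    (fun x _ _ ih hI => (sigmaPred_ex hp (hI.mono (Nat.le_succ _)) (ih hI) x).congr
      fun _ => not_forall)

theorem sigmaPred_of_isSigma {S : Str} (hp : PAminus S) {k : ℕ} (hI : IndPred S k) {φ : Fml}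
    (hφ : IsSigma k φ) : SigmaPred S k (fun v => Sat0 S v φ) :=
  (sigmaPred_of_isSigma_isPi hp).1 k φ hφ hI

theorem sigmaPred_of_isPi {S : Str} (hp : PAminus S) {k : ℕ} (hI : IndPred S k) {φ : Fml}
    (hφ : IsPi k φ) : SigmaPred S k (fun v => ¬ Sat0 S v φ) :=
  (sigmaPred_of_isSigma_isPi hp).2 k φ hφ hI

/-! ## Large predicates -/

/-- The valuation that takes its first `N` values from `l` and continues with `u`. -/
def app {α : Type} (N : ℕ) (l u : ℕ → α) : ℕ → α := fun i => if i < N then l i else u (i - N)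

theorem app_succ {α : Type} (N : ℕ) (l u : ℕ → α) :
    app (N + 1) l u = app N l (cons (l N) u) := by
  funext i
  simp only [app]
  rcases lt_trichotomy i N with h | rfl | h
  · simp [h, Nat.lt_succ_of_lt h]
  · simp [cons]
  · obtain ⟨j, rfl⟩ := Nat.exists_eq_add_of_lt h
    rw [if_neg (by omega), if_neg (by omega), show N + j + 1 - N = j + 1 by omega,
      show N + j + 1 - (N + 1) = j by omega]
    rfl

theorem sigmaPred_exists_app {S : Str} (hp : PAminus S) {k : ℕ} (hI : IndPred S k)
    {P : (ℕ → S.M) → Prop} (hP : SigmaPred S (k + 1) P) (N : ℕ) :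
    SigmaPred S (k + 1) (fun u => ∃ l, P (app N l u)) := by
  induction N with
  | zero =>
    refine hP.congr fun u => ?_
    have : ∀ l, app 0 l u = u := fun l => by funext i; simp [app]
    simp only [this]
    exact ⟨fun ⟨_, h⟩ => h, fun h => ⟨u, h⟩⟩
  | succ N ih =>
    refine ((hI.sigmaClosed hp).ex_succ hp ih).congr fun u => ?_
    constructor
    · rintro ⟨l, hl⟩
      exact ⟨l N, l, by rwa [← app_succ]⟩
    · rintro ⟨m, l, hl⟩
      refine ⟨upd l N m, ?_⟩
      rw [app_succ]
      convert hl using 1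
      funext i
      by_cases hi : i < N
      · simp [app, upd, hi, hi.ne]
      · simp [app, upd, hi]

/-- A predicate is large if the first coordinate is unbounded on it. -/
def Large (S : Str) (P : (ℕ → S.M) → Prop) : Prop := ∀ b, ∃ v, P v ∧ S.lt b (v 0)

theorem Large.mono {S : Str} {P Q : (ℕ → S.M) → Prop} (hP : Large S P) (h : ∀ v, P v → Q v) :
    Large S Q := fun b =>
  let ⟨v, hv, hb⟩ := hP b
  ⟨v, h v hv, hb⟩

theorem sigmaPred_not_large {S : Str} (hp : PAminus S) {k : ℕ} (hI : IndPred S (k + 1))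
    {P : (ℕ → S.M) → Prop} (hP : SigmaPred S (k + 1) P) :
    SigmaPred S (k + 2) (fun u => ¬ Large S fun v => P (cons (u 0) v)) := by
  obtain ⟨N, hN⟩ := hP.support
  have hR : SigmaPred S (k + 1) fun w => P (inst (cons (.inl (N + 2)) .inl) w) ∧
      S.lt (ev w (.inl (N + 1))) (ev w (.inl 0)) :=
    (hI.sigmaClosed hp).and (hP.subst _)
      ((SigmaPred.zero_lt _ _).mono (Nat.zero_le _))
  refine ⟨_, sigmaPred_exists_app hp (hI.mono k.le_succ) hR (N + 1), fun u => ?_⟩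
  simp only [Large, not_forall]
  refine exists_congr fun b => not_congr ⟨?_, ?_⟩
  · rintro ⟨v, hv, hb⟩
    refine ⟨v, (hN _ _ fun i hi => ?_).1 hv, ?_⟩
    · rcases i with _ | i
      · simp [cons, inst, ev, app]
      · have : i < N + 1 := by omega
        simp [cons, inst, ev, app, this]
    · simpa [ev, app, cons] using hb
  · rintro ⟨l, hl, hb⟩
    refine ⟨app (N + 1) l (cons b u), (hN _ _ fun i hi => ?_).1 hl, ?_⟩
    · rcases i with _ | i
      · simp [cons, inst, ev, app]
      · rfl
    · simpa [ev, app, cons] using hb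

/-- If a `Σₖ₊₁` family of predicates starts large and is not large at `a`, then it stops being
large at some point below `a`. -/
theorem Large.exists_last {S : Str} (hp : PAminus S) {k : ℕ} (hI : IndPred S (k + 2))
    {P : (ℕ → S.M) → Prop} (hP : SigmaPred S (k + 1) P) {a : S.M}
    (h0 : Large S fun v => P (cons S.zero v)) (ha : ¬ Large S fun v => P (cons a v)) :
    ∃ c, S.lt c a ∧ (Large S fun v => P (cons c v)) ∧
      ¬ Large S fun v => P (cons (S.add c S.one) v) := by
  by_contra! hcon
  have hI' := hI.mono (k + 1).le_succ
  have hcl := hI'.sigmaClosed hp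
  let ρ : ℕ → ℕ ⊕ S.M := cons (.inl 0) fun i => .inl (i + 2)
  have hρ : ∀ d z v, inst ρ (cons d (cons z v)) = cons d v := by
    intro d z v; funext i; rcases i with _ | i <;> rfl
  let R : (ℕ → S.M) → Prop := fun u => ∃ d, S.add (ev (cons d u) (.inl 0))
    (ev (cons d u) (.inl 1)) = ev (cons d u) (.inr a) ∧ P (inst ρ (cons d u))
  have hR : SigmaPred S (k + 1) R :=
    ((hI'.mono k.le_succ).sigmaClosed hp).ex_succ hp
      (hcl.and ((SigmaPred.zero_add _ _ _).mono (Nat.zero_le _)) (hP.subst ρ))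
  have hRP : ∀ d z v, S.add d z = a → (R (cons z v) ↔ P (cons d v)) := by
    intro d z v hd
    simp only [R, hρ, ev, Sum.elim_inl, Sum.elim_inr, cons, id]
    constructor
    · rintro ⟨d', hd', h⟩
      rwa [← hp.add_right_cancel (hd'.trans hd.symm)]
    · exact fun h => ⟨d, hd, h⟩
  have key := hcl.induction_le hp hI (sigmaPred_not_large hp hI' hR) (v := fun _ => a) (a := a)
  simp only [cons] at key
  refine key ?_ (fun z hz hlz hlz' => hlz ?_) ?_
  · simpa only [hRP a S.zero _ (hp.add_zero a)] using ha
  · obtain ⟨d, hd⟩ : ∃ d, S.add d (S.add z S.one) = a := by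
      rcases hp.discrete _ _ hz with h | h
      · exact ⟨S.zero, by rw [hp.zero_add, h]⟩
      · obtain ⟨d, hd⟩ := hp.sub _ _ h
        exact ⟨d, by rw [hp.add_comm, hd]⟩
    have hd' : S.add (S.add d S.one) z = a := by
      rw [hp.add_assoc, hp.add_comm S.one, hd]
    simp only [hRP _ _ _ hd] at hlz'
    simp only [hRP _ _ _ hd']
    refine hcon d ?_ hlz'
    have := hp.add_lt_add _ _ d (show S.lt S.zero (S.add z S.one) from ?_)
    · rwa [hp.zero_add, hp.add_comm, hd] at this
    · exact (hp.lt_succ_iff _ _).2 ((hp.zero_le z).symm.imp id Eq.symm)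
  · simpa only [hRP S.zero a _ (hp.zero_add a)] using h0

/-- If `P` is large but `P ∧ Q` is not, then some large restriction of `P` is disjoint
from `Q`. -/
theorem Large.exists_avoid {S : Str} (hp : PAminus S) {k : ℕ} (hcl : SigmaClosed S k)
    {P Q : (ℕ → S.M) → Prop} (hP : SigmaPred S k P) (hl : Large S P)
    (hPQ : ¬ Large S fun v => P v ∧ Q v) :
    ∃ P', SigmaPred S k P' ∧ Large S P' ∧ (∀ v, P' v → P v) ∧ ∀ v, P' v → ¬ Q v := by
  simp only [Large, not_forall, not_exists, not_and] at hPQ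
  obtain ⟨b, hb⟩ := hPQ
  refine ⟨fun v => P v ∧ S.lt b (v 0), hcl.and hP
    ((SigmaPred.zero_lt (.inr b) (.inl 0)).mono (Nat.zero_le _)), fun c => ?_,
    fun v hv => hv.1, fun v hv hQ => hb v ⟨hv.1, hQ⟩ hv.2⟩
  obtain ⟨d, hd, hcd⟩ := hp.exists_gt_gt b c
  obtain ⟨v, hv, hdv⟩ := hl d
  exact ⟨v, ⟨hv, hp.lt_trans _ _ _ hd hdv⟩, hp.lt_trans _ _ _ hcd hdv⟩

/-- Restriction deciding an existential predicate, with a variable as a witness. -/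
theorem Large.exists_henkin {S : Str} (hp : PAminus S) {k : ℕ} (hcl : SigmaClosed S k)
    {P Q : (ℕ → S.M) → Prop} (hP : SigmaPred S k P) (hQ : SigmaPred S k Q) (hl : Large S P) :
    ∃ P', SigmaPred S k P' ∧ Large S P' ∧ (∀ v, P' v → P v) ∧
      ((∀ v, P' v → ∀ m, ¬ Q (cons m v)) ∨ ∃ i, ∀ v, P' v → Q (cons (v i) v)) := by
  by_cases h : Large S fun v => P v ∧ ∃ m, Q (cons m v)
  · obtain ⟨N, hN⟩ := hP.support
    obtain ⟨N', hN'⟩ := hQ.support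
    let i := N + N' + 1
    have hi : ∀ (v : ℕ → S.M) m, ∀ j < i, v j = upd v i m j := fun v m j hj => by
      simp [upd, hj.ne]
    have hinst : ∀ v : ℕ → S.M, inst (cons (.inl i) .inl) v = cons (v i) v := by
      intro v; funext j; rcases j with _ | j <;> rfl
    refine ⟨fun v => P v ∧ Q (cons (v i) v), ?_, fun b => ?_, fun v hv => hv.1,
      .inr ⟨i, fun v hv => hv.2⟩⟩
    · exact (hcl.and hP (hQ.subst (cons (.inl i) .inl))).congr fun v => by rw [hinst]
    · obtain ⟨v, ⟨hv, m, hm⟩, hb⟩ := h b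
      refine ⟨upd v i m, ⟨(hN _ _ fun j hj => hi v m j (by omega)).1 hv, ?_⟩, ?_⟩
      · refine (hN' _ _ fun j hj => ?_).1 hm
        rcases j with _ | j
        · simp [cons, upd]
        · exact hi v m j (by omega)
      · rwa [← hi v m 0 (by omega)]
  · obtain ⟨P', hP', hl', h1, h2⟩ := hl.exists_avoid hp hcl hP h
    exact ⟨P', hP', hl', h1, .inl fun v hv m hm => h2 v hv ⟨m, hm⟩⟩

/-- Restriction deciding the least counterexample below `a`. -/
theorem Large.exists_least {S : Str} (hp : PAminus S) {k : ℕ} (hI : IndPred S (k + 2))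
    {P Q : (ℕ → S.M) → Prop} (hP : SigmaPred S (k + 1) P) (hQ : SigmaPred S (k + 1) Q)
    (hl : Large S P) (a : S.M) :
    ∃ P', SigmaPred S (k + 1) P' ∧ Large S P' ∧ (∀ v, P' v → P v) ∧
      ((∀ v, P' v → ∀ m, S.lt m a → Q (cons m v)) ∨
        ∃ c, S.lt c a ∧ ∀ v, P' v → (∀ m, S.lt m c → Q (cons m v)) ∧ ¬ Q (cons c v)) := by
  have hcl := (hI.mono (k + 1).le_succ).sigmaClosed hp
  let ρ : ℕ → ℕ ⊕ S.M := fun i => .inl (i + 1)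
  let ρ' : ℕ → ℕ ⊕ S.M := cons (.inl 0) fun i => .inl (i + 2)
  have hρ' : ∀ d z v, inst ρ' (cons d (cons z v)) = cons d v := by
    intro d z v; funext i; rcases i with _ | i <;> rfl
  let R : (ℕ → S.M) → Prop := fun u => P (inst ρ u) ∧
    ∀ m, S.lt m (ev u (.inl 0)) → Q (inst ρ' (cons m u))
  have hR : SigmaPred S (k + 1) R := hcl.and (hP.subst ρ) (hcl.ball _ (hQ.subst ρ'))
  have hR' : ∀ z v, R (cons z v) ↔ P v ∧ ∀ m, S.lt m z → Q (cons m v) := by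
    intro z v
    simp only [R, hρ']
    rfl
  have hRz : ∀ z, SigmaPred S (k + 1) fun v => R (cons z v) := by
    intro z
    refine (hR.subst (cons (.inr z) .inl)).congr fun v => ?_
    rw [show inst (cons (.inr z) .inl) v = cons z v by
      funext j; rcases j with _ | j <;> rfl]
  by_cases ha : Large S fun v => R (cons a v)
  · exact ⟨_, hRz a, ha, fun v hv => ((hR' _ _).1 hv).1, .inl fun v hv => ((hR' _ _).1 hv).2⟩
  · have h0 : Large S fun v => R (cons S.zero v) :=
      hl.mono fun v hv => (hR' _ _).2 ⟨hv, fun m hm => absurd hm (hp.not_lt_zero m)⟩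
    obtain ⟨c, hca, hc, hc'⟩ := Large.exists_last hp hI hR h0 ha
    obtain ⟨P', hP', hl', h1, h2⟩ := hc.exists_avoid (Q := fun v => Q (cons c v)) hp hcl (hRz c)
      fun h => hc' <| h.mono fun v hv => (hR' _ _).2 ⟨((hR' _ _).1 hv.1).1, fun m hm => by
        rcases (hp.lt_succ_iff m c).1 hm with hm | rfl
        · exact ((hR' _ _).1 hv.1).2 m hm
        · exact hv.2⟩
    exact ⟨P', hP', hl', fun v hv => ((hR' _ _).1 (h1 v hv)).1,
      .inr ⟨c, hca, fun v hv => ⟨((hR' _ _).1 (h1 v hv)).2, h2 v hv⟩⟩⟩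

/-! ## Generic filters -/

/-- A filter on valuations that contains the sets `{v | b < v 0}` and decides `Σₖ` predicates in
such a way that the variables form a model. -/
structure Generic (S : Str) (k : ℕ) (G : Filter (ℕ → S.M)) : Prop where
  neBot : G.NeBot
  base : ∀ b, ∀ᶠ v in G, S.lt b (v 0)
  henkin : ∀ Q, SigmaPred S k Q →
    (∀ᶠ v in G, ∀ m, ¬ Q (cons m v)) ∨ ∃ i, ∀ᶠ v in G, Q (cons (v i) v)
  least : ∀ Q, SigmaPred S k Q → ∀ a, (∀ᶠ v in G, ∀ m, S.lt m a → Q (cons m v)) ∨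
    ∃ c, S.lt c a ∧ ∀ᶠ v in G, (∀ m, S.lt m c → Q (cons m v)) ∧ ¬ Q (cons c v)

/-- Large `Σₖ` predicates, as forcing conditions. -/
structure Condition (S : Str) (k : ℕ) where
  pred : (ℕ → S.M) → Prop
  sigma : SigmaPred S k pred
  large : Large S pred

instance (S : Str) (k : ℕ) : Preorder (Condition S k) where
  le P Q := ∀ v, Q.pred v → P.pred v
  le_refl _ _ h := h
  le_trans _ _ _ h h' v hv := h v (h' v hv)

theorem exists_generic {S : Str} (hc : Countable S.M) (hp : PAminus S) {k : ℕ}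
    (hI : IndPred S (k + 2)) : ∃ G, Generic S (k + 1) G := by
  have hcl := (hI.mono (k + 1).le_succ).sigmaClosed hp
  let C := Condition S (k + 1)
  let T := {Q : (ℕ → S.M) → Prop // SigmaPred S (k + 1) Q}
  have hT : Countable T := (SigmaPred.countable hc (k + 1)).to_subtype
  let ι := S.M ⊕ T ⊕ T × S.M
  let req : ι → C → Prop := Sum.elim (fun b P => ∀ v, P.pred v → S.lt b (v 0)) <| Sum.elim
    (fun Q P => (∀ v, P.pred v → ∀ m, ¬ Q.1 (cons m v)) ∨ ∃ i, ∀ v, P.pred v → Q.1 (cons (v i) v))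
    fun Q P => (∀ v, P.pred v → ∀ m, S.lt m Q.2 → Q.1.1 (cons m v)) ∨
      ∃ c, S.lt c Q.2 ∧ ∀ v, P.pred v → (∀ m, S.lt m c → Q.1.1 (cons m v)) ∧ ¬ Q.1.1 (cons c v)
  have hreq : ∀ i P, ∃ P' ∈ {P' | req i P'}, P ≤ P' := by
    rintro (b | Q | ⟨Q, a⟩) ⟨P, hP, hl⟩
    · refine ⟨⟨fun v => P v ∧ S.lt b (v 0), hcl.and hP
        ((SigmaPred.zero_lt (.inr b) (.inl 0)).mono (Nat.zero_le _)), fun c => ?_⟩,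
        fun v hv => hv.2, fun v hv => hv.1⟩
      obtain ⟨d, hd, hd'⟩ := hp.exists_gt_gt b c
      obtain ⟨v, hv, hdv⟩ := hl d
      exact ⟨v, ⟨hv, hp.lt_trans _ _ _ hd hdv⟩, hp.lt_trans _ _ _ hd' hdv⟩
    · obtain ⟨P', hP', hl', h, h'⟩ := hl.exists_henkin hp hcl hP Q.2
      exact ⟨⟨P', hP', hl'⟩, h', h⟩
    · obtain ⟨P', hP', hl', h, h'⟩ := hl.exists_least hp hI hP Q.2 a
      exact ⟨⟨P', hP', hl'⟩, h', h⟩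
  have htriv : SigmaPred S (k + 1) fun v => ev v (.inl 0) = ev v (.inl 0) :=
    (SigmaPred.zero_eq _ _).mono (Nat.zero_le _)
  let p : C := ⟨_, htriv, fun b => ⟨fun _ => S.add b S.one, rfl, hp.lt_succ_self b⟩⟩
  let _ : Encodable ι := Encodable.ofCountable ι
  let D : ι → Order.Cofinal C := fun i => ⟨{P' | req i P'}, hreq i⟩
  let I := Order.idealOfCofinals p D
  let G : Filter (ℕ → S.M) := ⨅ P : I, Filter.principal {v | P.1.pred v}
  have hG : ∀ P ∈ I, ∀ᶠ v in G, P.pred v := fun P hP =>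
    Filter.mem_iInf_of_mem (⟨P, hP⟩ : I) (Filter.mem_principal_self _)
  have hmeet : ∀ i, ∃ P ∈ I, req i P := fun i =>
    let ⟨P, h, h'⟩ := Order.cofinal_meets_idealOfCofinals p D i
    ⟨P, h', h⟩
  refine ⟨G, ?_, fun b => ?_, fun Q hQ => ?_, fun Q hQ a => ?_⟩
  · have : Nonempty I := ⟨⟨p, Order.mem_idealOfCofinals p D⟩⟩
    refine Filter.iInf_neBot_of_directed' ?_ fun P => ?_
    · rintro ⟨P, hP⟩ ⟨Q, hQ⟩
      obtain ⟨R, hR, hPR, hQR⟩ := I.directed P hP Q hQ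
      exact ⟨⟨R, hR⟩, Filter.principal_mono.2 hPR, Filter.principal_mono.2 hQR⟩
    · obtain ⟨v, hv, -⟩ := P.1.large S.zero
      exact Filter.principal_neBot_iff.2 ⟨v, hv⟩
  · obtain ⟨P, hP, h⟩ := hmeet (.inl b)
    exact (hG P hP).mono h
  · obtain ⟨P, hP, h⟩ := hmeet (.inr (.inl ⟨Q, hQ⟩))
    exact h.imp (hG P hP).mono fun ⟨i, hi⟩ => ⟨i, (hG P hP).mono hi⟩
  · obtain ⟨P, hP, h⟩ := hmeet (.inr (.inr (⟨Q, hQ⟩, a)))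
    exact h.imp (hG P hP).mono fun ⟨c, hc, h⟩ => ⟨c, hc, (hG P hP).mono h⟩

namespace Generic

variable {S : Str} {k : ℕ} {G : Filter (ℕ → S.M)}

theorem eventually_or_not (hG : Generic S k G) {Q : (ℕ → S.M) → Prop} (hQ : SigmaPred S k Q) :
    (∀ᶠ v in G, Q v) ∨ ∀ᶠ v in G, ¬ Q v :=
  (hG.henkin _ (hQ.subst fun i => .inl (i + 1))).symm.imp
    (fun ⟨_, h⟩ => h) fun h => h.mono fun _ h => h S.zero

theorem exists_var (hG : Generic S k G) {f : (ℕ → S.M) → S.M}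
    (hf : SigmaPred S k fun v => f (fun i => v (i + 1)) = v 0) : ∃ i, ∀ᶠ v in G, f v = v i := by
  have := hG.neBot
  rcases hG.henkin _ hf with h | ⟨i, h⟩
  · obtain ⟨v, hv⟩ := h.exists
    exact absurd rfl (hv (f v))
  · exact ⟨i, h⟩

theorem exists_const (hG : Generic S k G) (a : S.M) : ∃ i, ∀ᶠ v in G, a = v i :=
  hG.exists_var (f := fun _ => a) ((SigmaPred.zero_eq (.inr a) (.inl 0)).mono (Nat.zero_le _))

theorem exists_add (hG : Generic S k G) (i j : ℕ) : ∃ r, ∀ᶠ v in G, S.add (v i) (v j) = v r :=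
  hG.exists_var (f := fun v => S.add (v i) (v j))
    ((SigmaPred.zero_add (.inl (i + 1)) (.inl (j + 1)) (.inl 0)).mono (Nat.zero_le _))

theorem exists_mul (hG : Generic S k G) (i j : ℕ) : ∃ r, ∀ᶠ v in G, S.mul (v i) (v j) = v r :=
  hG.exists_var (f := fun v => S.mul (v i) (v j))
    ((SigmaPred.zero_mul (.inl (i + 1)) (.inl (j + 1)) (.inl 0)).mono (Nat.zero_le _))

/-- A variable that is bounded by an element of the ground model is constant. -/
theorem exists_eq_const (hG : Generic S k G) (hp : PAminus S) {i : ℕ} {a : S.M}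
    (h : ∀ᶠ v in G, S.lt (v i) a) : ∃ c, S.lt c a ∧ ∀ᶠ v in G, v i = c := by
  have := hG.neBot
  have hQ : SigmaPred S k fun v => ¬ S.lt (ev v (.inl (i + 1))) (ev v (.inl 0)) :=
    (SigmaPred.zero_lt _ _).zero_not.mono (Nat.zero_le _)
  have key : ∀ c, (∀ᶠ v in G, (∀ m, S.lt m c → ¬ S.lt (v i) m) ∧ S.lt (v i) c) →
      ∃ d, S.lt d c ∧ ∀ᶠ v in G, v i = d := by
    intro c hc
    rcases hp.eq_zero_or_succ c with rfl | ⟨d, rfl⟩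
    · obtain ⟨v, hv⟩ := hc.exists
      exact absurd hv.2 (hp.not_lt_zero _)
    · refine ⟨d, hp.lt_succ_self d, hc.mono fun v hv => ?_⟩
      exact ((hp.lt_succ_iff _ _).1 hv.2).resolve_left (hv.1 d (hp.lt_succ_self d))
  rcases hG.least _ hQ a with h' | ⟨c, hca, h'⟩
  · exact key a (h'.and h)
  · obtain ⟨d, hd, hid⟩ := key c (h'.mono fun v hv => ⟨hv.1, not_not.1 hv.2⟩)
    exact ⟨d, hp.lt_trans _ _ _ hd hca, hid⟩

/-! ## The generic model -/

/-- The model whose elements are the germs of the variables. -/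
def model (hG : Generic S k G) : Str where
  M := {g : G.Germ S.M // ∃ i, g = ((fun v => v i : (ℕ → S.M) → S.M) : G.Germ S.M)}
  zero := ⟨((fun _ => S.zero : (ℕ → S.M) → S.M) : G.Germ S.M),
    (hG.exists_const S.zero).imp fun _ h => Filter.Germ.coe_eq.2 h⟩
  one := ⟨((fun _ => S.one : (ℕ → S.M) → S.M) : G.Germ S.M),
    (hG.exists_const S.one).imp fun _ h => Filter.Germ.coe_eq.2 h⟩
  add a b := ⟨Filter.Germ.map₂ S.add a.1 b.1, by
    obtain ⟨⟨_, i, rfl⟩, _, j, rfl⟩ := a, b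
    exact (hG.exists_add i j).imp fun _ h => Filter.Germ.coe_eq.2 h⟩
  mul a b := ⟨Filter.Germ.map₂ S.mul a.1 b.1, by
    obtain ⟨⟨_, i, rfl⟩, _, j, rfl⟩ := a, b
    exact (hG.exists_mul i j).imp fun _ h => Filter.Germ.coe_eq.2 h⟩
  lt a b := Filter.Germ.LiftRel S.lt a.1 b.1

/-- The element of the model named by a variable. -/
def cls (hG : Generic S k G) (i : ℕ) : hG.model.M := ⟨_, i, rfl⟩

theorem exists_cls (hG : Generic S k G) (a : hG.model.M) : ∃ i, a = hG.cls i :=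
  let ⟨_, i, h⟩ := a
  ⟨i, Subtype.ext h⟩

theorem cls_lt (hG : Generic S k G) {i j : ℕ} :
    hG.model.lt (hG.cls i) (hG.cls j) ↔ ∀ᶠ v in G, S.lt (v i) (v j) := Iff.rfl

theorem tval_model (hG : Generic S k G) (σ : ℕ → ℕ) (t : Term) :
    (tval hG.model (fun i => hG.cls (σ i)) t).1 =
      ((fun v => tval S (fun i => v (σ i)) t : (ℕ → S.M) → S.M) : G.Germ S.M) := by
  induction t with
  | var | zero | one => rfl
  | add t u iht ihu => exact congr_arg₂ (Filter.Germ.map₂ S.add) iht ihu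
  | mul t u iht ihu => exact congr_arg₂ (Filter.Germ.map₂ S.mul) iht ihu

/-- Truth of `φ` in the model is the same as eventual truth along the filter. -/
def Los (hG : Generic S k G) (φ : Fml) : Prop :=
  ∀ σ : ℕ → ℕ, Sat0 hG.model (fun i => hG.cls (σ i)) φ ↔ ∀ᶠ v in G, Sat0 S (fun i => v (σ i)) φ

theorem upd_cls (hG : Generic S k G) (σ : ℕ → ℕ) (x i : ℕ) :
    upd (fun i => hG.cls (σ i)) x (hG.cls i) = fun j => hG.cls (upd σ x i j) := by
  funext j
  simp only [upd]
  split_ifs <;> rfl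

theorem upd_var (v : ℕ → S.M) (σ : ℕ → ℕ) (x i : ℕ) :
    upd (fun i => v (σ i)) x (v i) = fun j => v (upd σ x i j) := by
  funext j
  simp only [upd]
  split_ifs <;> rfl

theorem forall_upd (hG : Generic S k G) {σ : ℕ → ℕ} {x : ℕ} {p : (ℕ → hG.model.M) → Prop} :
    (∀ m, p (upd (fun i => hG.cls (σ i)) x m)) ↔ ∀ i, p fun j => hG.cls (upd σ x i j) := by
  refine ⟨fun h i => hG.upd_cls σ x i ▸ h _, fun h m => ?_⟩
  obtain ⟨i, rfl⟩ := hG.exists_cls m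
  rw [upd_cls]
  exact h i

theorem not_eventually_not (hG : Generic S k G) {Q : (ℕ → S.M) → Prop} (hQ : SigmaPred S k Q)
    (σ : ℕ → ℕ) : (∀ᶠ v in G, ¬ Q fun i => v (σ i)) ↔ ¬ ∀ᶠ v in G, Q fun i => v (σ i) := by
  have := hG.neBot
  constructor
  · intro h h'
    obtain ⟨v, hv, hv'⟩ := (h.and h').exists
    exact hv hv'
  · exact (hG.eventually_or_not (hQ.subst fun i => .inl (σ i))).resolve_left

theorem Los.ex {hG : Generic S k G} {φ : Fml} (hφ : SigmaPred S k fun v => Sat0 S v φ)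
    (h : hG.Los φ) (x : ℕ) : hG.Los (.ex x φ) := by
  intro σ
  have := hG.neBot
  constructor
  · rintro ⟨m, hm⟩
    obtain ⟨i, rfl⟩ := hG.exists_cls m
    rw [upd_cls] at hm
    exact ((h _).1 hm).mono fun v hv => ⟨v i, by rwa [upd_var]⟩
  · intro hex
    rcases hG.henkin _ (hφ.rename_upd σ x) with h' | ⟨i, h'⟩
    · obtain ⟨v, ⟨m, hm⟩, hv⟩ := (hex.and h').exists
      exact absurd hm (hv m)
    · refine ⟨hG.cls i, ?_⟩
      rw [upd_cls]
      refine (h _).2 (h'.mono fun v hv => ?_)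
      rw [← upd_var]
      exact hv

theorem Los.all {hG : Generic S k G} {φ : Fml} (hφ : SigmaPred S k fun v => ¬ Sat0 S v φ)
    (h : hG.Los φ) (x : ℕ) : hG.Los (.all x φ) := by
  intro σ
  have := hG.neBot
  refine (hG.forall_upd (p := fun v => Sat0 hG.model v φ)).trans
    ⟨fun hall => ?_, fun hall i => (h _).2 ?_⟩
  · rcases hG.henkin _ (hφ.rename_upd σ x) with h' | ⟨i, h'⟩
    · exact h'.mono fun v hv m => not_not.1 (hv m)
    · obtain ⟨v, hv, hv'⟩ := (h'.and ((h _).1 (hall i))).exists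
      rw [← upd_var] at hv'
      exact absurd hv' hv
  · refine Filter.Eventually.mono hall fun v hv => ?_
    rw [← upd_var]
    exact hv _

theorem Los.not {hG : Generic S k G} {φ : Fml} (hφ : SigmaPred S k fun v => Sat0 S v φ)
    (h : hG.Los φ) : hG.Los (.not φ) := fun σ =>
  (not_congr (h σ)).trans (hG.not_eventually_not hφ σ).symm

theorem Los.and {hG : Generic S k G} {φ ψ : Fml} (h : hG.Los φ) (h' : hG.Los ψ) :
    hG.Los (.and φ ψ) := fun σ =>
  (and_congr (h σ) (h' σ)).trans Filter.eventually_and.symm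

/-- The property `Los` only depends on the semantics of the formula. -/
theorem Los.congr {hG : Generic S k G} {φ ψ : Fml} (h : hG.Los φ)
    (hφψ : ∀ K v, Sat0 K v φ ↔ Sat0 K v ψ) : hG.Los ψ := fun σ => by
  simpa only [hφψ] using h σ

theorem los_delta0 (hG : Generic S k G) {φ : Fml} (hφ : Delta0 φ) : hG.Los φ := by
  have hs : ∀ {ψ}, Delta0 ψ → SigmaPred S k fun v => Sat0 S v ψ := fun h =>
    (sigmaPred_of_delta0 h).mono (Nat.zero_le _)
  have hlt : ∀ t u, hG.Los (.lt t u) := fun t u σ => by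
    simp only [Sat0, Sat, model]
    erw [tval_model, tval_model]
    rfl
  have hbex : ∀ x t {ψ}, Delta0 ψ → hG.Los ψ → hG.Los (.bex x t ψ) := by
    intro x t ψ hψ ih σ
    have := hG.neBot
    obtain ⟨i, hi⟩ := hG.exists_cls (tval hG.model (fun i => hG.cls (σ i)) t)
    have hi' : ∀ᶠ v in G, tval S (fun i => v (σ i)) t = v i :=
      Filter.Germ.coe_eq.1 ((hG.tval_model σ t).symm.trans (congr_arg Subtype.val hi))
    constructor
    · rintro ⟨m, hmt, hm⟩
      obtain ⟨j, rfl⟩ := hG.exists_cls m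
      rw [hi, cls_lt] at hmt
      rw [upd_cls] at hm
      filter_upwards [hmt, (ih _).1 hm, hi'] with v hv hv' hvi
      exact ⟨v j, hvi ▸ hv, by rwa [upd_var]⟩
    · intro hex
      have hQ : SigmaPred S k fun v => S.lt (ev v (.inl 0)) (ev v (.inl (i + 1))) ∧
          Sat0 S (upd (fun i => v (σ i + 1)) x (v 0)) ψ :=
        ((SigmaPred.zero_lt _ _).zero_and ((sigmaPred_of_delta0 hψ).rename_upd σ x)).mono
          (Nat.zero_le _)
      rcases hG.henkin _ hQ with h | ⟨j, h⟩
      · obtain ⟨v, ⟨m, hmt, hm⟩, hv, hvi⟩ := (hex.and (h.and hi')).exists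
        rw [hvi] at hmt
        exact absurd ⟨hmt, hm⟩ (hv m)
      · refine ⟨hG.cls j, ?_, ?_⟩
        · rw [hi, cls_lt]
          exact h.mono fun v hv => hv.1
        · rw [upd_cls]
          refine (ih _).2 (h.mono fun v hv => ?_)
          rw [← upd_var]
          exact hv.2
  induction hφ with
  | eq t u =>
    intro σ
    refine Subtype.ext_iff.trans ?_
    rw [tval_model, tval_model]
    exact Filter.Germ.coe_eq
  | lt t u => exact hlt t u
  | not hφ ih => exact ih.not (hs hφ)
  | and _ _ ih ih' => exact ih.and ih'
  | or hφ hψ ih ih' =>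
    exact (((ih.not (hs hφ)).and (ih'.not (hs hψ))).not (hs (hφ.not.and hψ.not))).congr
      fun K v => by simp only [Sat0, Sat]; tauto
  | imp hφ hψ ih ih' =>
    exact ((ih.and (ih'.not (hs hψ))).not (hs (hφ.and hψ.not))).congr
      fun K v => by simp only [Sat0, Sat]; tauto
  | bex x t hφ ih => exact hbex x t hφ ih
  | ball x t hφ ih =>
    exact ((hbex x t hφ.not (ih.not (hs hφ))).not (hs (.bex x t hφ.not))).congr
      fun K v => by simp only [Sat0, Sat]; push Not; rfl

theorem los_isSigma_isPi (hG : Generic S k G) (hp : PAminus S) (hI : IndPred S k) :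
    (∀ j φ, IsSigma j φ → j ≤ k → hG.Los φ) ∧ ∀ j φ, IsPi j φ → j ≤ k → hG.Los φ := by
  have key := isSigma_isPi_induction (p := fun j φ => j ≤ k → IsSigma j φ ∧ hG.Los φ)
    (q := fun j φ => j ≤ k → IsPi j φ ∧ hG.Los φ)
    (fun j φ h => ⟨fun _ => ⟨.delta0 h, hG.los_delta0 h⟩, fun _ => ⟨.delta0 h, hG.los_delta0 h⟩⟩)
    (fun j φ ih hj => (ih (Nat.le_of_succ_le hj)).imp_left .ofPi)
    (fun x j φ ih hj => ⟨.ex x (ih hj).1,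
      (ih hj).2.ex ((sigmaPred_of_isSigma hp (hI.mono hj) (ih hj).1).mono hj) x⟩)
    (fun j φ ih hj => (ih (Nat.le_of_succ_le hj)).imp_left .ofSigma)
    (fun x j φ ih hj => ⟨.all x (ih hj).1,
      (ih hj).2.all ((sigmaPred_of_isPi hp (hI.mono hj) (ih hj).1).mono hj) x⟩)
  exact ⟨fun j φ h hj => (key.1 j φ h hj).2, fun j φ h hj => (key.2 j φ h hj).2⟩

/-- The canonical embedding of the ground model into the generic model. -/
def emb (hG : Generic S k G) : Emb S hG.model where
  j a := ⟨((fun _ => a : (ℕ → S.M) → S.M) : G.Germ S.M),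
    (hG.exists_const a).imp fun _ h => Filter.Germ.coe_eq.2 h⟩
  inj a b h := by
    have := hG.neBot
    exact Filter.Germ.const_inj.1 (congr_arg Subtype.val h)
  zero := rfl
  one := rfl
  add _ _ := rfl
  mul _ _ := rfl
  lt_iff a b := by
    have := hG.neBot
    exact Filter.Germ.liftRel_const_iff.symm

theorem emb_eq_cls (hG : Generic S k G) {a : S.M} {i : ℕ} :
    hG.emb.j a = hG.cls i ↔ ∀ᶠ v in G, a = v i :=
  Subtype.ext_iff.trans Filter.Germ.coe_eq

theorem cls_lt_emb (hG : Generic S k G) {a : S.M} {i : ℕ} :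
    hG.model.lt (hG.cls i) (hG.emb.j a) ↔ ∀ᶠ v in G, S.lt (v i) a := Iff.rfl

theorem isProper (hG : Generic S k G) (hp : PAminus S) : IsProper hG.emb := by
  intro h
  have := hG.neBot
  obtain ⟨a, ha⟩ := h (hG.cls 0)
  obtain ⟨v, hav, hlt⟩ := ((hG.emb_eq_cls.1 ha).and (hG.base a)).exists
  exact hp.lt_irrefl _ (hav ▸ hlt)

/-- Every element below the image of the ground model is in the image. -/
theorem exists_emb_of_lt (hG : Generic S k G) (hp : PAminus S) {b : hG.model.M} {a : S.M}
    (h : hG.model.lt b (hG.emb.j a)) : ∃ c, S.lt c a ∧ hG.emb.j c = b := by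
  obtain ⟨i, rfl⟩ := hG.exists_cls b
  obtain ⟨c, hc, hi⟩ := hG.exists_eq_const hp (hG.cls_lt_emb.1 h)
  exact ⟨c, hc, hG.emb_eq_cls.2 (hi.mono fun _ => Eq.symm)⟩

theorem isEndExt (hG : Generic S k G) (hp : PAminus S) : IsEndExt hG.emb := by
  intro b hb a
  obtain ⟨i, rfl⟩ := hG.exists_cls b
  have hlt : SigmaPred S k fun v => S.lt (ev v (.inr a)) (ev v (.inl i)) :=
    (SigmaPred.zero_lt _ _).mono (Nat.zero_le _)
  refine (hG.eventually_or_not hlt).resolve_right fun h => hb ?_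
  have : hG.model.lt (hG.cls i) (hG.emb.j (S.add a S.one)) := by
    refine hG.cls_lt_emb.2 (h.mono fun v hv => (hp.lt_succ_iff _ _).2 ?_)
    rcases hp.lt_total a (v i) with h' | h' | h'
    exacts [absurd h' hv, .inr h'.symm, .inl h']
  obtain ⟨c, -, hc⟩ := hG.exists_emb_of_lt hp this
  exact ⟨c, hc⟩

/-- `Σₖ₊₁` formulas true in the generic model are eventually true in the ground model. -/
theorem eventually_of_isSigma (hG : Generic S k G) (hp : PAminus S) (hI : IndPred S k)
    {φ : Fml} (hφ : IsSigma (k + 1) φ) (σ : ℕ → ℕ)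
    (h : Sat0 hG.model (fun i => hG.cls (σ i)) φ) : ∀ᶠ v in G, Sat0 S (fun i => v (σ i)) φ := by
  refine IsSigma.induction (p := fun j φ => j ≤ k + 1 → ∀ σ : ℕ → ℕ,
    Sat0 hG.model (fun i => hG.cls (σ i)) φ → ∀ᶠ v in G, Sat0 S (fun i => v (σ i)) φ)
    (fun j φ h _ σ => (hG.los_delta0 h σ).1) (fun j φ h hj σ =>
      ((hG.los_isSigma_isPi hp hI).2 j φ h (Nat.le_of_succ_le_succ hj) σ).1)
    (fun x j φ ih hj σ => ?_) hφ le_rfl σ h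
  rintro ⟨m, hm⟩
  obtain ⟨i, rfl⟩ := hG.exists_cls m
  rw [upd_cls] at hm
  exact (ih hj _ hm).mono fun v hv => ⟨v i, by rwa [upd_var]⟩

theorem sigmaElem (hG : Generic S k G) (hp : PAminus S) (hI : IndPred S (k + 1)) :
    SigmaElem hG.emb (k + 1) := by
  have hI' := hI.mono k.le_succ
  have := hG.neBot
  have hconst : ∀ u : ℕ → S.M, ∃ σ : ℕ → ℕ, ∀ i, hG.emb.j (u i) = hG.cls (σ i) := fun u => by
    choose σ hσ using fun i => hG.exists_const (u i)
    exact ⟨σ, fun i => hG.emb_eq_cls.2 (hσ i)⟩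
  have hsupp : ∀ (σ : ℕ → ℕ) (u : ℕ → S.M), (∀ i, hG.emb.j (u i) = hG.cls (σ i)) →
      ∀ (j : ℕ) (P : (ℕ → S.M) → Prop), SigmaPred S j P → ∀ᶠ v in G, P u ↔ P fun i => v (σ i) := by
    intro σ u hσ j P hP
    obtain ⟨N, hN⟩ := hP.support
    have : ∀ᶠ v in G, ∀ i ∈ Finset.range N, u i = v (σ i) :=
      (Filter.eventually_all_finset _).2 fun i _ => hG.emb_eq_cls.1 (hσ i)
    exact this.mono fun v hv => hN _ _ fun i hi => hv i (Finset.mem_range.2 hi)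
  intro φ hφ u
  constructor
  · refine fun h => IsSigma.induction (p := fun j φ => j ≤ k + 1 → ∀ u : ℕ → S.M,
      Sat0 S u φ → Sat0 hG.model (fun i => hG.emb.j (u i)) φ)
      (fun j φ h _ u hu => ?_) (fun j φ h hj u hu => ?_) (fun x j φ ih hj u => ?_) hφ le_rfl u h
    · obtain ⟨σ, hσ⟩ := hconst u
      simp only [hσ]
      exact (hG.los_delta0 h σ).2 <| (hsupp σ u hσ 0 _ (sigmaPred_of_delta0 h)).mono
        fun v hv => hv.1 hu
    · obtain ⟨σ, hσ⟩ := hconst u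
      have hj := Nat.le_of_succ_le_succ hj
      simp only [hσ]
      exact ((hG.los_isSigma_isPi hp hI').2 j φ h hj σ).2 <|
        (hsupp σ u hσ j _ (sigmaPred_of_isPi hp (hI'.mono hj) h)).mono
          fun v hv => (not_iff_not.1 hv).1 hu
    · rintro ⟨m, hm⟩
      refine ⟨hG.emb.j m, ?_⟩
      rw [show upd (fun i => hG.emb.j (u i)) x (hG.emb.j m) = fun i => hG.emb.j (upd u x m i) by
        funext i; simp only [upd]; split_ifs <;> rfl]
      exact ih hj _ hm
  · intro h
    obtain ⟨σ, hσ⟩ := hconst u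
    simp only [hσ] at h
    obtain ⟨v, hv, hv'⟩ := ((hG.eventually_of_isSigma hp hI' hφ σ h).and
      (hsupp σ u hσ _ _ (sigmaPred_of_isSigma hp hI hφ))).exists
    exact hv'.2 hv

theorem mISigma (hG : Generic S k G) (hp : PAminus S) (hI : IndPred S k) :
    MISigma hG.emb k := by
  intro φ hφ u x a h0 hstep b hb
  have := hG.neBot
  obtain ⟨σ, hσ⟩ : ∃ σ : ℕ → ℕ, u = fun i => hG.cls (σ i) := by
    choose σ hσ using fun i => hG.exists_cls (u i)
    exact ⟨σ, funext hσ⟩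
  subst hσ
  have hlos := (hG.los_isSigma_isPi hp hI).1 k φ hφ le_rfl
  have hsat : ∀ c, Sat0 hG.model (upd (fun i => hG.cls (σ i)) x (hG.emb.j c)) φ ↔
      ∀ᶠ v in G, Sat0 S (upd (fun i => v (σ i)) x c) φ := by
    intro c
    obtain ⟨i, hi⟩ := hG.exists_const c
    rw [hG.emb_eq_cls.2 hi, upd_cls, hlos]
    refine Filter.eventually_congr (hi.mono fun v hv => ?_)
    rw [← upd_var, hv]
  obtain ⟨d, hd, rfl⟩ := hG.exists_emb_of_lt hp hb
  rw [hsat]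
  rcases hG.least _ ((sigmaPred_of_isSigma hp hI hφ).rename_upd σ x) a with h | ⟨c, hca, h⟩
  · exact h.mono fun v hv => hv d hd
  · have hc : ¬ Sat0 hG.model (upd (fun i => hG.cls (σ i)) x (hG.emb.j c)) φ := by
      rw [hsat]
      intro h'
      obtain ⟨v, hv, hv'⟩ := (h.and h').exists
      exact absurd hv' hv.2
    rcases hp.eq_zero_or_succ c with rfl | ⟨e, rfl⟩
    · exact absurd h0 hc
    · have hec := hp.lt_succ_self e
      refine absurd (hstep (hG.emb.j e) ?_ ?_) hc
      · exact (hG.emb.lt_iff _ _).1 (hp.lt_trans _ _ _ hec hca)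
      · exact (hsat e).2 (h.mono fun v hv => hv.1 e hec)

end Generic

/-- Theorem `thm:clote`.
For each `n ∈ ℕ` and every countable model `M ⊨ IΣₙ₊₂`, there is a proper
`Σₙ₊₂`-elementary end extension `M ≼_{e,Σₙ₊₂} K` such that
`K ⊨ M‑IΣₙ₊₁`. -/
theorem statement_11 (n : ℕ) (S : Str) (hc : Countable S.M)
    (h : ISigma S (n + 2)) :
    ∃ (K : Str) (e : Emb S K),
      IsProper e ∧ IsEndExt e ∧ SigmaElem e (n + 2) ∧ MISigma e (n + 1) := by
  have hI := h.indPred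
  obtain ⟨G, hG⟩ := exists_generic hc h.1 hI
  exact ⟨_, hG.emb, hG.isProper h.1, hG.isEndExt h.1, hG.sigmaElem h.1 hI,
    hG.mISigma h.1 (hI.mono (n + 1).le_succ)⟩

end PaperArith
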